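/- Let {φ_i ⊗ ψ_i}_{i=1}^5 be a general Unextendible Product Basis in ℂ^3 ⊗ ℂ^3 (five nonzero product vectors such that no nonzero product vector is orthogonal to all of them). Then there exists a PPT state ρ of rank 4 on ℂ^3 ⊗ ℂ^3 with φ_i ⊗ ψ_i in the kernel of ρ for every i = 1, …, 5 if and only if there exists a permutation κ of {1, …, 5} such that the invariants s_1, s_2, s_3, s_4 computed from the permuted vectors φ_{κ(1)}, …, φ_{κ(5)} and ψ_{κ(1)}, …, ψ_{κ(5)} are all positive real numbers. -/

import Mathlib

open scoped ComplexConjugate ComplexOrder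

/-- The standard Hermitian inner product, conjugate-linear in the first argument. -/
noncomputable def hinner {α : Type*} [Fintype α] (x y : α → ℂ) : ℂ :=
  ∑ a, conj (x a) * y a

/-- The product vector `φ ⊗ ψ` in `ℂ^n ⊗ ℂ^m`, identified with `Fin n × Fin m → ℂ`. -/
noncomputable def prodVec {n m : ℕ} (φ : Fin n → ℂ) (ψ : Fin m → ℂ) :
    Fin n × Fin m → ℂ :=
  fun p => φ p.1 * ψ p.2

/-- The partial transpose with respect to the first subsystem:
`ρ^{T1}((i,j),(k,l)) = ρ((k,j),(i,l))`. -/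
noncomputable def pt {n m : ℕ} (ρ : Matrix (Fin n × Fin m) (Fin n × Fin m) ℂ) :
    Matrix (Fin n × Fin m) (Fin n × Fin m) ℂ :=
  Matrix.of fun a b => ρ (b.1, a.2) (a.1, b.2)

/-- Determinant of the 3×3 matrix with columns `u`, `v`, `w`. -/
noncomputable def det3 (u v w : Fin 3 → ℂ) : ℂ :=
  Matrix.det (Matrix.of fun i j => ![u, v, w] j i)

/-- The invariant `s₁` of five vectors in `ℂ^3`. -/
noncomputable def s1 (φ : Fin 5 → Fin 3 → ℂ) : ℂ :=
  (-(det3 (φ 0) (φ 1) (φ 3) * det3 (φ 0) (φ 2) (φ 4))) /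
    (det3 (φ 0) (φ 1) (φ 4) * det3 (φ 0) (φ 2) (φ 3))

/-- The invariant `s₂` of five vectors in `ℂ^3`. -/
noncomputable def s2 (φ : Fin 5 → Fin 3 → ℂ) : ℂ :=
  (-(det3 (φ 0) (φ 1) (φ 2) * det3 (φ 1) (φ 3) (φ 4))) /
    (det3 (φ 0) (φ 1) (φ 3) * det3 (φ 1) (φ 2) (φ 4))

/-- The invariant `s₃` of five vectors in `ℂ^3`. -/
noncomputable def s3 (ψ : Fin 5 → Fin 3 → ℂ) : ℂ :=
  (-(det3 (ψ 0) (ψ 2) (ψ 1) * det3 (ψ 0) (ψ 4) (ψ 3))) /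
    (det3 (ψ 0) (ψ 2) (ψ 3) * det3 (ψ 0) (ψ 4) (ψ 1))

/-- The invariant `s₄` of five vectors in `ℂ^3`. -/
noncomputable def s4 (ψ : Fin 5 → Fin 3 → ℂ) : ℂ :=
  (-(det3 (ψ 0) (ψ 2) (ψ 4) * det3 (ψ 2) (ψ 1) (ψ 3))) /
    (det3 (ψ 0) (ψ 2) (ψ 1) * det3 (ψ 2) (ψ 4) (ψ 3))

/-- A complex number is a positive real. -/
def IsPosReal (z : ℂ) : Prop := z.im = 0 ∧ 0 < z.re

lemma det3_eq (u v w : Fin 3 → ℂ) : det3 u v w =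
    u 0 * v 1 * w 2 - u 0 * v 2 * w 1 - u 1 * v 0 * w 2 + u 2 * v 0 * w 1
      + u 1 * v 2 * w 0 - u 2 * v 1 * w 0 := by
  simp [det3, Matrix.det_fin_three]
  ring

/-- The Cramer rule in `ℂ^3`. -/
lemma det3_smul_eq (a b c v : Fin 3 → ℂ) :
    det3 a b c • v = det3 v b c • a + det3 a v c • b + det3 a b v • c := by
  ext i
  fin_cases i <;> simp [det3_eq] <;> ring

/-- Every triple of the five vectors is linearly independent. -/
def GenPos (χ : Fin 5 → Fin 3 → ℂ) : Prop :=
  ∀ i j k, i ≠ j → i ≠ k → j ≠ k → det3 (χ i) (χ j) (χ k) ≠ 0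

lemma GenPos.comp {χ : Fin 5 → Fin 3 → ℂ} (h : GenPos χ) (κ : Equiv.Perm (Fin 5)) :
    GenPos (χ ∘ κ) := fun _ _ _ hij hik hjk =>
  h _ _ _ (κ.injective.ne hij) (κ.injective.ne hik) (κ.injective.ne hjk)

lemma hinner_prodVec {n m : ℕ} (φ f : Fin n → ℂ) (ψ g : Fin m → ℂ) :
    hinner (prodVec φ ψ) (prodVec f g) = hinner φ f * hinner ψ g := by
  simp only [hinner, prodVec, Fintype.sum_prod_type, Finset.sum_mul_sum, map_mul]
  exact Finset.sum_congr rfl fun i _ => Finset.sum_congr rfl fun j _ => by ring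

lemma exists_orthogonal_of_det3_eq_zero {a b c : Fin 3 → ℂ} (h : det3 a b c = 0) :
    ∃ f : Fin 3 → ℂ, f ≠ 0 ∧ hinner a f = 0 ∧ hinner b f = 0 ∧ hinner c f = 0 := by
  have hdet : (Matrix.of ![star a, star b, star c]).det = 0 := by
    have h' := congrArg conj h
    rw [det3_eq] at h'
    simp only [map_add, map_sub, map_mul, map_zero] at h'
    rw [Matrix.det_fin_three]
    simp [Matrix.cons_val_two, Matrix.vecHead, Matrix.vecTail]
    linear_combination h'
  obtain ⟨f, hf, hfm⟩ := Matrix.exists_mulVec_eq_zero_iff.2 hdet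
  refine ⟨f, hf, ?_, ?_, ?_⟩
  · simpa [Matrix.mulVec, dotProduct, hinner] using congrFun hfm 0
  · simpa [Matrix.mulVec, dotProduct, hinner] using congrFun hfm 1
  · simpa [Matrix.mulVec, dotProduct, hinner] using congrFun hfm 2

lemma exists_complementary_pair : ∀ i j k : Fin 5, i ≠ j → i ≠ k → j ≠ k →
    ∃ l m : Fin 5, ∀ x, x = i ∨ x = j ∨ x = k ∨ x = l ∨ x = m := by
  decide

lemma det3_self_right (a b : Fin 3 → ℂ) : det3 a b b = 0 := by
  rw [det3_eq]; ring

lemma genPos_left_of_unextendible {φ ψ : Fin 5 → Fin 3 → ℂ}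
    (h : ¬ ∃ (f g : Fin 3 → ℂ), f ≠ 0 ∧ g ≠ 0 ∧
      ∀ i, hinner (prodVec (φ i) (ψ i)) (prodVec f g) = 0) : GenPos φ := by
  intro i j k hij hik hjk h0
  obtain ⟨l, m, hlm⟩ := exists_complementary_pair i j k hij hik hjk
  obtain ⟨f, hf, hfi, hfj, hfk⟩ := exists_orthogonal_of_det3_eq_zero h0
  obtain ⟨g, hg, hgl, hgm, -⟩ :=
    exists_orthogonal_of_det3_eq_zero (det3_self_right (ψ l) (ψ m))
  refine h ⟨f, g, hf, hg, fun x => ?_⟩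
  rw [hinner_prodVec]
  rcases hlm x with rfl | rfl | rfl | rfl | rfl <;> simp [*]

lemma genPos_right_of_unextendible {φ ψ : Fin 5 → Fin 3 → ℂ}
    (h : ¬ ∃ (f g : Fin 3 → ℂ), f ≠ 0 ∧ g ≠ 0 ∧
      ∀ i, hinner (prodVec (φ i) (ψ i)) (prodVec f g) = 0) : GenPos ψ := by
  refine genPos_left_of_unextendible (ψ := φ) ?_
  rintro ⟨f, g, hf, hg, hfg⟩
  refine h ⟨g, f, hg, hf, fun i => ?_⟩
  have := hfg i
  rw [hinner_prodVec] at this ⊢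
  rw [mul_comm, this]

/-- The sesquilinear form of `ρ` evaluated on product vectors. -/
noncomputable def prodForm (ρ : Matrix (Fin 3 × Fin 3) (Fin 3 × Fin 3) ℂ)
    (x y x' y' : Fin 3 → ℂ) : ℂ :=
  star (prodVec x y) ⬝ᵥ ρ.mulVec (prodVec x' y')

/-- The properties of the numbers `⟨φ_i ⊗ ψ_j, ρ (φ_k ⊗ ψ_l)⟩` for a PPT state `ρ` of rank four
whose kernel contains all `φ_i ⊗ ψ_i`. -/
structure IsGram (φ ψ : Fin 5 → Fin 3 → ℂ) (G : Fin 5 → Fin 5 → Fin 5 → Fin 5 → ℂ) : Prop where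
  left_genPos : GenPos φ
  right_genPos : GenPos ψ
  herm : ∀ i j k l, conj (G i j k l) = G k l i j
  kernel : ∀ i j k, G i j k k = 0
  cross : ∀ i j k, G i j k i = 0
  cramer_left : ∀ a b c i j k l, det3 (φ a) (φ b) (φ c) * G i j k l =
    det3 (φ k) (φ b) (φ c) * G i j a l + det3 (φ a) (φ k) (φ c) * G i j b l +
      det3 (φ a) (φ b) (φ k) * G i j c l
  cramer_right : ∀ a b c i j k l, det3 (ψ a) (ψ b) (ψ c) * G i j k l =
    det3 (ψ l) (ψ b) (ψ c) * G i j k a + det3 (ψ a) (ψ l) (ψ c) * G i j k b +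
      det3 (ψ a) (ψ b) (ψ l) * G i j k c
  cauchy_schwarz : ∀ i j k l, 0 ≤ G i j i j * G k l k l - G i j k l * G k l i j
  diag_ne_zero : ∀ i j, i ≠ j → G i j i j ≠ 0

lemma prodVec_add_right {n m : ℕ} (x : Fin n → ℂ) (y z : Fin m → ℂ) :
    prodVec x (y + z) = prodVec x y + prodVec x z := by
  ext p; simp [prodVec, mul_add]

lemma prodVec_add_left {n m : ℕ} (x z : Fin n → ℂ) (y : Fin m → ℂ) :
    prodVec (x + z) y = prodVec x y + prodVec z y := by
  ext p; simp [prodVec, add_mul]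

lemma prodVec_smul_right {n m : ℕ} (a : ℂ) (x : Fin n → ℂ) (y : Fin m → ℂ) :
    prodVec x (a • y) = a • prodVec x y := by
  ext p; simp [prodVec]; ring

lemma prodVec_smul_left {n m : ℕ} (a : ℂ) (x : Fin n → ℂ) (y : Fin m → ℂ) :
    prodVec (a • x) y = a • prodVec x y := by
  ext p; simp [prodVec]; ring

lemma prodForm_herm {ρ : Matrix (Fin 3 × Fin 3) (Fin 3 × Fin 3) ℂ} (hρ : ρ.IsHermitian)
    (x y x' y' : Fin 3 → ℂ) :
    conj (prodForm ρ x y x' y') = prodForm ρ x' y' x y := by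
  rw [prodForm, prodForm, starRingEnd_apply, Matrix.star_dotProduct, star_star,
    Matrix.star_mulVec, hρ.eq, Matrix.dotProduct_mulVec]

lemma prodForm_eq_zero_of_mulVec {ρ : Matrix (Fin 3 × Fin 3) (Fin 3 × Fin 3) ℂ}
    {x' y' : Fin 3 → ℂ} (h : ρ.mulVec (prodVec x' y') = 0) (x y : Fin 3 → ℂ) :
    prodForm ρ x y x' y' = 0 := by
  rw [prodForm, h, dotProduct_zero]

lemma prodForm_pt (ρ : Matrix (Fin 3 × Fin 3) (Fin 3 × Fin 3) ℂ) (x y x' y' : Fin 3 → ℂ) :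
    prodForm (pt ρ) x y x' y' = prodForm ρ (star x') y (star x) y' := by
  simp only [prodForm, dotProduct, Matrix.mulVec, pt, prodVec, Pi.star_apply, Matrix.of_apply,
    Finset.mul_sum, Fintype.sum_prod_type, star_mul', star_star]
  simp only [Fin.sum_univ_three]
  ring

lemma prodForm_cross {ρ : Matrix (Fin 3 × Fin 3) (Fin 3 × Fin 3) ℂ} (hpt : (pt ρ).PosSemidef)
    {x y : Fin 3 → ℂ} (h : ρ.mulVec (prodVec x y) = 0) (x' y' : Fin 3 → ℂ) :
    prodForm ρ x y' x' y = 0 := by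
  have h0 : (pt ρ).mulVec (prodVec (star x) y) = 0 := by
    rw [← hpt.dotProduct_mulVec_zero_iff]
    have := prodForm_pt ρ (star x) y (star x) y
    rw [star_star, prodForm_eq_zero_of_mulVec h] at this
    exact this
  have := prodForm_pt ρ (star x') y' (star x) y
  rw [star_star, star_star, prodForm_eq_zero_of_mulVec h0] at this
  exact this.symm

lemma prodForm_cauchy_schwarz {ρ : Matrix (Fin 3 × Fin 3) (Fin 3 × Fin 3) ℂ}
    (hρ : ρ.PosSemidef) (x y x' y' : Fin 3 → ℂ) :
    0 ≤ prodForm ρ x y x y * prodForm ρ x' y' x' y' -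
      prodForm ρ x y x' y' * prodForm ρ x' y' x y := by
  let C : Matrix (Fin 3 × Fin 3) (Fin 2) ℂ :=
    Matrix.of fun p s => ![prodVec x y p, prodVec x' y' p] s
  have h := (hρ.conjTranspose_mul_mul_same C).det_nonneg
  have key : ∀ s t, (C.conjTranspose * ρ * C) s t =
      star (fun p => C p s) ⬝ᵥ ρ.mulVec (fun p => C p t) := by
    intro s t
    rw [Matrix.mul_assoc]
    rfl
  rw [Matrix.det_fin_two, key, key, key, key] at h
  exact h

/-- The functional `x ⊗ y ↦ |a b x| |c d y|`. -/
noncomputable def detFunctional (a b c d : Fin 3 → ℂ) : (Fin 3 × Fin 3 → ℂ) →ₗ[ℂ] ℂ where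
  toFun v := ∑ p, ∑ q, v (p, q) * (det3 a b (Pi.single p 1) * det3 c d (Pi.single q 1))
  map_add' u v := by simp [add_mul, Finset.sum_add_distrib]
  map_smul' r v := by simp [Finset.mul_sum, mul_assoc]

lemma detFunctional_prodVec (a b c d x y : Fin 3 → ℂ) :
    detFunctional a b c d (prodVec x y) = det3 a b x * det3 c d y := by
  simp [detFunctional, prodVec, Fin.sum_univ_three, det3_eq]
  ring

set_option synthInstance.maxHeartbeats 400000 in
set_option synthInstance.maxSize 1000 in
lemma exists_separating_index : ∀ k i j : Fin 5, i ≠ j → ∃ a b d e : Fin 5,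
    (a = i ∨ d = j) ∧ a ≠ b ∧ a ≠ k ∧ b ≠ k ∧ d ≠ e ∧ d ≠ k ∧ e ≠ k ∧
      ∀ x, x = k ∨ x = a ∨ x = b ∨ x = d ∨ x = e := by
  decide +kernel

lemma det3_self_outer (a b : Fin 3 → ℂ) : det3 a b a = 0 := by
  rw [det3_eq]; ring

lemma coeff_eq_zero {φ ψ : Fin 5 → Fin 3 → ℂ} (hφ : GenPos φ) (hψ : GenPos ψ) {c : Fin 5 → ℂ}
    {r : ℂ} {i j : Fin 5} (hij : i ≠ j)
    (h : ∑ k, c k • prodVec (φ k) (ψ k) = r • prodVec (φ i) (ψ j)) (k : Fin 5) : c k = 0 := by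
  obtain ⟨a, b, d, e, hi, hab, hak, hbk, hde, hdk, hek, hx⟩ := exists_separating_index k i j hij
  have h1 := congrArg (detFunctional (φ a) (φ b) (ψ d) (ψ e)) h
  simp only [map_sum, map_smul, detFunctional_prodVec, smul_eq_mul] at h1
  rw [Finset.sum_eq_single k] at h1
  · have h2 : det3 (φ a) (φ b) (φ i) * det3 (ψ d) (ψ e) (ψ j) = 0 := by
      rcases hi with rfl | rfl <;> simp [det3_self_outer]
    rw [h2, mul_zero] at h1
    exact (mul_eq_zero.1 h1).resolve_right
      (mul_ne_zero (hφ _ _ _ hab hak hbk) (hψ _ _ _ hde hdk hek))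
  · intro x _ hxk
    rcases hx x with rfl | rfl | rfl | rfl | rfl
    · exact absurd rfl hxk
    all_goals simp [det3_self_outer, det3_self_right]
  · simp

lemma linearIndependent_prodVec {φ ψ : Fin 5 → Fin 3 → ℂ} (hφ : GenPos φ) (hψ : GenPos ψ) :
    LinearIndependent ℂ fun k => prodVec (φ k) (ψ k) := by
  rw [Fintype.linearIndependent_iff]
  intro c hc
  exact coeff_eq_zero hφ hψ (r := 0) (i := 0) (j := 1) (by decide) (by rw [hc, zero_smul])

lemma GenPos.ne_zero {χ : Fin 5 → Fin 3 → ℂ} (h : GenPos χ) (i : Fin 5) : χ i ≠ 0 := by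
  intro h0
  obtain ⟨j, k, hij, hik, hjk⟩ : ∃ j k, i ≠ j ∧ i ≠ k ∧ j ≠ k := by
    clear h0; revert i; decide
  exact h i j k hij hik hjk (by rw [h0, det3_eq]; simp)

lemma mulVec_prodVec_ne_zero {φ ψ : Fin 5 → Fin 3 → ℂ} (hφ : GenPos φ) (hψ : GenPos ψ)
    {ρ : Matrix (Fin 3 × Fin 3) (Fin 3 × Fin 3) ℂ} (hrank : ρ.rank = 4)
    (hker : ∀ i, ρ.mulVec (prodVec (φ i) (ψ i)) = 0) {i j : Fin 5} (hij : i ≠ j) :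
    ρ.mulVec (prodVec (φ i) (ψ j)) ≠ 0 := by
  intro h0
  have hspan : Submodule.span ℂ (Set.range fun k => prodVec (φ k) (ψ k)) =
      LinearMap.ker ρ.mulVecLin := by
    apply Submodule.eq_of_le_of_finrank_eq
    · rw [Submodule.span_le]
      rintro _ ⟨k, rfl⟩
      exact hker k
    · rw [finrank_span_eq_card (linearIndependent_prodVec hφ hψ)]
      have := ρ.mulVecLin.finrank_range_add_finrank_ker
      rw [Matrix.rank] at hrank
      simp [hrank] at this ⊢
      omega
  have hmem : prodVec (φ i) (ψ j) ∈ LinearMap.ker ρ.mulVecLin := h0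
  rw [← hspan, Submodule.mem_span_range_iff_exists_fun] at hmem
  obtain ⟨c, hc⟩ := hmem
  have hc0 := coeff_eq_zero hφ hψ (r := 1) hij (by rw [one_smul]; exact hc)
  simp only [hc0, zero_smul, Finset.sum_const_zero] at hc
  obtain ⟨p, hp⟩ := Function.ne_iff.1 (hφ.ne_zero i)
  obtain ⟨q, hq⟩ := Function.ne_iff.1 (hψ.ne_zero j)
  exact mul_ne_zero hp hq (congrFun hc (p, q)).symm

lemma isGram_prodForm {φ ψ : Fin 5 → Fin 3 → ℂ} (hφ : GenPos φ) (hψ : GenPos ψ)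
    {ρ : Matrix (Fin 3 × Fin 3) (Fin 3 × Fin 3) ℂ} (hρ : ρ.PosSemidef)
    (hpt : (pt ρ).PosSemidef) (hrank : ρ.rank = 4)
    (hker : ∀ i, ρ.mulVec (prodVec (φ i) (ψ i)) = 0) :
    IsGram φ ψ fun i j k l => prodForm ρ (φ i) (ψ j) (φ k) (ψ l) where
  left_genPos := hφ
  right_genPos := hψ
  herm i j k l := prodForm_herm hρ.1 _ _ _ _
  kernel i j k := prodForm_eq_zero_of_mulVec (hker k) _ _
  cross i j k := prodForm_cross hpt (hker i) _ _
  cramer_left a b c i j k l := by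
    have h := congrArg (fun z => star (prodVec (φ i) (ψ j)) ⬝ᵥ ρ.mulVec (prodVec z (ψ l)))
      (det3_smul_eq (φ a) (φ b) (φ c) (φ k))
    simpa only [prodForm, prodVec_add_left, prodVec_smul_left, Matrix.mulVec_add,
      Matrix.mulVec_smul, dotProduct_add, dotProduct_smul, smul_eq_mul] using h
  cramer_right a b c i j k l := by
    have h := congrArg (fun z => star (prodVec (φ i) (ψ j)) ⬝ᵥ ρ.mulVec (prodVec (φ k) z))
      (det3_smul_eq (ψ a) (ψ b) (ψ c) (ψ l))
    simpa only [prodForm, prodVec_add_right, prodVec_smul_right, Matrix.mulVec_add,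
      Matrix.mulVec_smul, dotProduct_add, dotProduct_smul, smul_eq_mul] using h
  cauchy_schwarz i j k l := prodForm_cauchy_schwarz hρ _ _ _ _
  diag_ne_zero i j hij h := mulVec_prodVec_ne_zero hφ hψ hrank hker hij
    ((hρ.dotProduct_mulVec_zero_iff _).1 h)

namespace IsGram

variable {φ ψ : Fin 5 → Fin 3 → ℂ} {G : Fin 5 → Fin 5 → Fin 5 → Fin 5 → ℂ}

lemma comp (h : IsGram φ ψ G) (κ : Equiv.Perm (Fin 5)) :
    IsGram (φ ∘ κ) (ψ ∘ κ) fun i j k l => G (κ i) (κ j) (κ k) (κ l) where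
  left_genPos := h.left_genPos.comp κ
  right_genPos := h.right_genPos.comp κ
  herm _ _ _ _ := h.herm _ _ _ _
  kernel _ _ _ := h.kernel _ _ _
  cross _ _ _ := h.cross _ _ _
  cramer_left _ _ _ _ _ _ _ := h.cramer_left _ _ _ _ _ _ _
  cramer_right _ _ _ _ _ _ _ := h.cramer_right _ _ _ _ _ _ _
  cauchy_schwarz _ _ _ _ := h.cauchy_schwarz _ _ _ _
  diag_ne_zero _ _ hij := h.diag_ne_zero _ _ (κ.injective.ne hij)

lemma cross' (h : IsGram φ ψ G) (i j l : Fin 5) : G i j j l = 0 := by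
  have := h.herm j l i j
  rw [h.cross, map_zero] at this
  exact this.symm

lemma swap (h : IsGram φ ψ G) : IsGram ψ φ fun i j k l => G j i l k where
  left_genPos := h.right_genPos
  right_genPos := h.left_genPos
  herm _ _ _ _ := h.herm _ _ _ _
  kernel _ _ _ := h.kernel _ _ _
  cross _ _ _ := h.cross' _ _ _
  cramer_left _ _ _ _ _ _ _ := h.cramer_right _ _ _ _ _ _ _
  cramer_right _ _ _ _ _ _ _ := h.cramer_left _ _ _ _ _ _ _
  cauchy_schwarz _ _ _ _ := h.cauchy_schwarz _ _ _ _
  diag_ne_zero _ _ hij := h.diag_ne_zero _ _ hij.symm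

lemma right_ratio (h : IsGram φ ψ G) (i j k l l' : Fin 5) :
    G i j k l * det3 (ψ i) (ψ k) (ψ l') = G i j k l' * det3 (ψ i) (ψ k) (ψ l) := by
  have h1 := h.cramer_right i k l i j k l'
  rw [h.cross, h.kernel] at h1
  linear_combination -h1

lemma left_ratio (h : IsGram φ ψ G) (i j k k' l : Fin 5) :
    G i j k l * det3 (φ j) (φ l) (φ k') = G i j k' l * det3 (φ j) (φ l) (φ k) :=
  h.swap.right_ratio j i l k k'

lemma diag_expansion (h : IsGram φ ψ G) :
    det3 (ψ 0) (ψ 2) (ψ 3) * G 0 1 0 1 =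
      det3 (ψ 0) (ψ 1) (ψ 3) * G 0 1 0 2 + det3 (ψ 0) (ψ 2) (ψ 1) * G 0 1 0 3 := by
  have h1 := h.cramer_right 0 2 3 0 1 0 1
  rw [h.kernel] at h1
  linear_combination h1

lemma offDiag_ne_zero (h : IsGram φ ψ G) : G 0 1 2 3 ≠ 0 := by
  intro h0
  have hφ := h.left_genPos
  have hψ := h.right_genPos
  have e1 : G 0 1 0 3 = 0 := by
    have := h.left_ratio 0 1 0 2 3
    rw [h0, zero_mul] at this
    exact (mul_eq_zero.1 this).resolve_right (hφ _ _ _ (by decide) (by decide) (by decide))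
  have e2 : G 0 1 2 4 = 0 := by
    have := h.right_ratio 0 1 2 4 3
    rw [h0, zero_mul] at this
    exact (mul_eq_zero.1 this).resolve_right (hψ _ _ _ (by decide) (by decide) (by decide))
  have e3 : G 0 1 3 4 = 0 := by
    have := h.left_ratio 0 1 3 2 4
    rw [e2, zero_mul] at this
    exact (mul_eq_zero.1 this).resolve_right (hφ _ _ _ (by decide) (by decide) (by decide))
  have e4 : G 0 1 3 2 = 0 := by
    have := h.right_ratio 0 1 3 2 4
    rw [e3, zero_mul] at this
    exact (mul_eq_zero.1 this).resolve_right (hψ _ _ _ (by decide) (by decide) (by decide))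
  have e5 : G 0 1 0 2 = 0 := by
    have := h.left_ratio 0 1 0 3 2
    rw [e4, zero_mul] at this
    exact (mul_eq_zero.1 this).resolve_right (hφ _ _ _ (by decide) (by decide) (by decide))
  have e6 := h.diag_expansion
  rw [e1, e5, mul_zero, mul_zero, add_zero] at e6
  exact (mul_eq_zero.1 e6).elim (hψ _ _ _ (by decide) (by decide) (by decide))
    (h.diag_ne_zero _ _ (by decide))

end IsGram

/-- The cross-ratio of the lines through `χ 0` and `χ 1`, `χ 2`, `χ 3`, `χ 4`. -/
noncomputable def crossRatio (χ : Fin 5 → Fin 3 → ℂ) : ℂ :=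
  (det3 (χ 0) (χ 3) (χ 1) * det3 (χ 0) (χ 4) (χ 2)) /
    (det3 (χ 0) (χ 3) (χ 2) * det3 (χ 0) (χ 4) (χ 1))

lemma IsGram.conj_crossRatio {φ ψ : Fin 5 → Fin 3 → ℂ} {G : Fin 5 → Fin 5 → Fin 5 → Fin 5 → ℂ}
    (h : IsGram φ ψ G) : conj (crossRatio ψ) = crossRatio ψ := by
  have hψ := h.right_genPos
  have d031 := hψ 0 3 1 (by decide) (by decide) (by decide)
  have d032 := hψ 0 3 2 (by decide) (by decide) (by decide)
  have d041 := hψ 0 4 1 (by decide) (by decide) (by decide)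
  have d042 := hψ 0 4 2 (by decide) (by decide) (by decide)
  have f123 := h.left_genPos 1 2 3 (by decide) (by decide) (by decide)
  have f124 := h.left_genPos 1 2 4 (by decide) (by decide) (by decide)
  have n0132 : G 0 1 3 2 ≠ 0 := (h.comp (Equiv.swap 2 3)).offDiag_ne_zero
  have n0142 : G 0 1 4 2 ≠ 0 :=
    (h.comp ((Equiv.swap 2 4).trans (Equiv.swap 2 3))).offDiag_ne_zero
  have n3102 : G 3 1 0 2 ≠ 0 := by
    rw [← h.herm 0 2 3 1]
    exact (map_ne_zero _).2
      (h.comp ((Equiv.swap 1 2).trans (Equiv.swap 1 3))).offDiag_ne_zero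
  have n4102 : G 4 1 0 2 ≠ 0 := by
    rw [← h.herm 0 2 4 1]
    exact (map_ne_zero _).2
      (h.comp (((Equiv.swap 2 4).trans (Equiv.swap 1 3)).trans (Equiv.swap 2 3))).offDiag_ne_zero
  have r1 := h.right_ratio 0 1 3 1 2
  have r2 := h.right_ratio 0 1 4 2 1
  have r3 := h.left_ratio 0 1 3 4 2
  have r4 := h.right_ratio 3 1 0 1 2
  have r5 := h.right_ratio 4 1 0 2 1
  have r6 := congrArg conj (h.left_ratio 0 2 3 4 1)
  simp only [map_mul, h.herm] at r6
  rw [show det3 (φ 2) (φ 1) (φ 4) = -det3 (φ 1) (φ 2) (φ 4) by simp only [det3_eq]; ring,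
    show det3 (φ 2) (φ 1) (φ 3) = -det3 (φ 1) (φ 2) (φ 3) by simp only [det3_eq]; ring] at r6
  rw [show det3 (ψ 3) (ψ 0) (ψ 2) = -det3 (ψ 0) (ψ 3) (ψ 2) by simp only [det3_eq]; ring,
    show det3 (ψ 3) (ψ 0) (ψ 1) = -det3 (ψ 0) (ψ 3) (ψ 1) by simp only [det3_eq]; ring] at r4
  rw [show det3 (ψ 4) (ψ 0) (ψ 2) = -det3 (ψ 0) (ψ 4) (ψ 2) by simp only [det3_eq]; ring,
    show det3 (ψ 4) (ψ 0) (ψ 1) = -det3 (ψ 0) (ψ 4) (ψ 1) by simp only [det3_eq]; ring] at r5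
  simp only [map_neg, mul_neg, neg_inj] at r4 r5 r6
  have n0141 : G 0 1 4 1 ≠ 0 := fun h0 => by
    rw [h0, zero_mul] at r2
    exact mul_ne_zero n0142 d041 r2
  have n4101 : G 4 1 0 1 ≠ 0 := fun h0 => by
    rw [h0, zero_mul] at r5
    exact mul_ne_zero n4102 d041 r5
  have c124 : conj (det3 (φ 1) (φ 2) (φ 4)) ≠ 0 := (map_ne_zero _).2 f124
  have c123 : conj (det3 (φ 1) (φ 2) (φ 3)) ≠ 0 := (map_ne_zero _).2 f123
  have e1 : G 0 1 3 1 / G 0 1 4 1 =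
      crossRatio ψ * (det3 (φ 1) (φ 2) (φ 3) / det3 (φ 1) (φ 2) (φ 4)) := by
    rw [crossRatio, eq_div_of_mul_eq d032 r1, eq_div_of_mul_eq f124 r3,
      eq_div_of_mul_eq d042 r2.symm]
    field_simp
  have e2 : G 3 1 0 1 / G 4 1 0 1 =
      crossRatio ψ * (conj (det3 (φ 1) (φ 2) (φ 3)) / conj (det3 (φ 1) (φ 2) (φ 4))) := by
    rw [crossRatio, eq_div_of_mul_eq d032 r4, eq_div_of_mul_eq c124 r6,
      eq_div_of_mul_eq d042 r5.symm]
    field_simp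
  have e3 := congrArg conj e1
  simp only [map_div₀, map_mul, h.herm] at e3
  rw [e2] at e3
  exact (mul_right_cancel₀ (div_ne_zero c123 c124) e3).symm

/-- The brackets of `χ` are those of points with real parameters `t i` on a conic,
scaled by weights `w i`. -/
def IsConicParam (χ : Fin 5 → Fin 3 → ℂ) (t : Fin 5 → ℝ) (w : Fin 5 → ℂ) (c : ℂ) : Prop :=
  ∀ i j k, det3 (χ i) (χ j) (χ k) =
    c * w i * w j * w k * ((t j - t i) * (t k - t i) * (t k - t j))

lemma IsConicParam.comp {χ : Fin 5 → Fin 3 → ℂ} {t : Fin 5 → ℝ} {w : Fin 5 → ℂ} {c : ℂ}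
    (h : IsConicParam χ t w c) (κ : Equiv.Perm (Fin 5)) :
    IsConicParam (χ ∘ κ) (t ∘ κ) (w ∘ κ) c := fun _ _ _ => h _ _ _

lemma IsConicParam.of_eq_smul {χ : Fin 5 → Fin 3 → ℂ} {t : Fin 5 → ℝ} {w : Fin 5 → ℂ}
    {p q r : Fin 3 → ℂ}
    (h : ∀ i, χ i = w i • (p + (t i : ℂ) • q + ((t i : ℂ) ^ 2) • r)) :
    IsConicParam χ t w (det3 p q r) := by
  intro i j k
  rw [h i, h j, h k]
  simp only [det3_eq, Pi.add_apply, Pi.smul_apply, smul_eq_mul]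
  ring

lemma exists_real_avoiding (a b : ℝ) : ∃ l : ℝ, l ≠ 0 ∧ l ≠ a ∧ l ≠ b ∧ l ≠ 1 := by
  obtain ⟨l, hl⟩ := Infinite.exists_notMem_finset ({0, a, b, 1} : Finset ℝ)
  simp only [Finset.mem_insert, Finset.mem_singleton, not_or] at hl
  exact ⟨l, hl⟩

lemma exists_conicParam_of_coords {χ : Fin 5 → Fin 3 → ℂ} {a0 a1 a2 c0 : ℂ} {q0 q1 : ℝ}
    (ha0 : a0 ≠ 0) (ha1 : a1 ≠ 0) (ha2 : a2 ≠ 0) (hc0 : c0 ≠ 0) (hq0 : q0 ≠ 0) (hq1 : q1 ≠ 0)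
    (h01 : q0 ≠ q1) (h02 : q0 ≠ 1) (h12 : q1 ≠ 1)
    (h3 : χ 3 = a0 • χ 0 + a1 • χ 1 + a2 • χ 2)
    (h4 : χ 4 = (c0 * q0 * a0) • χ 0 + (c0 * q1 * a1) • χ 1 + (c0 * a2) • χ 2) :
    ∃ t w c, IsConicParam χ t w c := by
  obtain ⟨l, hl, hl0, hl1, hl2⟩ := exists_real_avoiding q0 q1
  let T0 : ℝ := q0 / (q0 - l)
  let T1 : ℝ := q1 / (q1 - l)
  let T2 : ℝ := 1 / (1 - l)
  have hC : ∀ {x y : ℝ}, x ≠ y → (x : ℂ) - y ≠ 0 := fun h => by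
    rw [← Complex.ofReal_sub]; exact_mod_cast sub_ne_zero.2 h
  have d0 := hC hl0.symm
  have d1 := hC hl1.symm
  have d2 : (1 : ℂ) - l ≠ 0 := by exact_mod_cast hC hl2.symm
  have hl' : (l : ℂ) ≠ 0 := by exact_mod_cast hl
  have hq0' : (q0 : ℂ) ≠ 0 := by exact_mod_cast hq0
  have hq1' : (q1 : ℂ) ≠ 0 := by exact_mod_cast hq1
  have e0 : (T0 : ℂ) = q0 / (q0 - l) := by simp [T0]
  have e1 : (T1 : ℂ) = q1 / (q1 - l) := by simp [T1]
  have e2 : (T2 : ℂ) = 1 / (1 - l) := by simp [T2]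
  have n0 : (T0 : ℂ) ≠ 0 := by rw [e0]; exact div_ne_zero hq0' d0
  have n1 : (T1 : ℂ) ≠ 0 := by rw [e1]; exact div_ne_zero hq1' d1
  have n2 : (T2 : ℂ) ≠ 0 := by rw [e2]; exact div_ne_zero one_ne_zero d2
  have f01 : (q0 : ℂ) - q1 ≠ 0 := hC h01
  have f02 : (q0 : ℂ) - 1 ≠ 0 := by exact_mod_cast hC h02
  have f12 : (q1 : ℂ) - 1 ≠ 0 := by exact_mod_cast hC h12
  have g01 : (T0 : ℂ) - T1 ≠ 0 := by
    have : (T0 : ℂ) - T1 = -l * (q0 - q1) / ((q0 - l) * (q1 - l)) := by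
      rw [e0, e1]; field_simp; ring
    rw [this]
    exact div_ne_zero (mul_ne_zero (neg_ne_zero.2 hl') f01) (mul_ne_zero d0 d1)
  have g02 : (T0 : ℂ) - T2 ≠ 0 := by
    have : (T0 : ℂ) - T2 = -l * (q0 - 1) / ((q0 - l) * (1 - l)) := by
      rw [e0, e2]; field_simp; ring
    rw [this]
    exact div_ne_zero (mul_ne_zero (neg_ne_zero.2 hl') f02) (mul_ne_zero d0 d2)
  have g12 : (T1 : ℂ) - T2 ≠ 0 := by
    have : (T1 : ℂ) - T2 = -l * (q1 - 1) / ((q1 - l) * (1 - l)) := by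
      rw [e1, e2]; field_simp; ring
    rw [this]
    exact div_ne_zero (mul_ne_zero (neg_ne_zero.2 hl') f12) (mul_ne_zero d1 d2)
  have g10 : (T1 : ℂ) - T0 ≠ 0 := by rw [← neg_sub]; exact neg_ne_zero.2 g01
  have g20 : (T2 : ℂ) - T0 ≠ 0 := by rw [← neg_sub]; exact neg_ne_zero.2 g02
  have g21 : (T2 : ℂ) - T1 ≠ 0 := by rw [← neg_sub]; exact neg_ne_zero.2 g12
  have m0 : 1 - 1 / (T0 : ℂ) = l / q0 := by rw [e0]; field_simp; ring
  have m1 : 1 - 1 / (T1 : ℂ) = l / q1 := by rw [e1]; field_simp; ring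
  have m2 : 1 - 1 / (T2 : ℂ) = l := by rw [e2]; field_simp; ring
  have curve : ∀ T : ℂ, a0 • χ 0 + a1 • χ 1 + a2 • χ 2 +
      T • (-(a0 * (1 / T1 + 1 / T2)) • χ 0 - (a1 * (1 / T0 + 1 / T2)) • χ 1 -
        (a2 * (1 / T0 + 1 / T1)) • χ 2) +
      T ^ 2 • ((a0 / (T1 * T2)) • χ 0 + (a1 / (T0 * T2)) • χ 1 + (a2 / (T0 * T1)) • χ 2) =
      (a0 * (1 - T / T1) * (1 - T / T2)) • χ 0 + (a1 * (1 - T / T0) * (1 - T / T2)) • χ 1 +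
        (a2 * (1 - T / T0) * (1 - T / T1)) • χ 2 := by
    intro T
    ext x
    simp only [Pi.add_apply, Pi.smul_apply, Pi.sub_apply, smul_eq_mul]
    field_simp
    ring
  refine ⟨![T0, T1, T2, 0, 1],
    ![T1 * T2 / ((T0 - T1) * (T0 - T2) * a0), T0 * T2 / ((T1 - T0) * (T1 - T2) * a1),
      T0 * T1 / ((T2 - T0) * (T2 - T1) * a2), 1, c0 * q0 * q1 / l ^ 2], _,
    IsConicParam.of_eq_smul fun i => (Eq.trans ?_ (congrArg _ (curve _).symm))⟩
  fin_cases i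
  · ext x
    simp [n0]
    field_simp
    ring
  · ext x
    simp [n1]
    field_simp
    ring
  · ext x
    simp [n2]
    field_simp
    ring
  · simp [h3]
  · simp only [one_div] at m0 m1 m2
    simp [m0, m1, m2, h4, smul_smul]
    congr 2 <;> field_simp

lemma eq_combination {a b c : Fin 3 → ℂ} (h : det3 a b c ≠ 0) (v : Fin 3 → ℂ) :
    v = (det3 b c v / det3 a b c) • a + (-det3 a c v / det3 a b c) • b +
      (det3 a b v / det3 a b c) • c := by
  have h1 := det3_smul_eq a b c v
  rw [show det3 v b c = det3 b c v by simp only [det3_eq]; ring,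
    show det3 a v c = -det3 a c v by simp only [det3_eq]; ring] at h1
  rw [← smul_right_inj h, h1]
  simp only [smul_add, smul_smul, mul_div_cancel₀ _ h]

lemma exists_conicParam {χ : Fin 5 → Fin 3 → ℂ} (hχ : GenPos χ)
    (h1 : conj (crossRatio χ) = crossRatio χ)
    (h0 : conj (crossRatio (χ ∘ Equiv.swap 0 1)) = crossRatio (χ ∘ Equiv.swap 0 1)) :
    ∃ t w c, IsConicParam χ t w c := by
  obtain ⟨q1, hq1⟩ := Complex.conj_eq_iff_real.1 h1
  obtain ⟨q0, hq0⟩ := Complex.conj_eq_iff_real.1 h0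
  have hq0 : det3 (χ 1) (χ 3) (χ 0) * det3 (χ 1) (χ 4) (χ 2) /
    (det3 (χ 1) (χ 3) (χ 2) * det3 (χ 1) (χ 4) (χ 0)) = q0 := hq0
  have d012 := hχ 0 1 2 (by decide) (by decide) (by decide)
  have d013 := hχ 0 1 3 (by decide) (by decide) (by decide)
  have d014 := hχ 0 1 4 (by decide) (by decide) (by decide)
  have d023 := hχ 0 2 3 (by decide) (by decide) (by decide)
  have d024 := hχ 0 2 4 (by decide) (by decide) (by decide)
  have d123 := hχ 1 2 3 (by decide) (by decide) (by decide)
  have d124 := hχ 1 2 4 (by decide) (by decide) (by decide)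
  have d034 := hχ 0 3 4 (by decide) (by decide) (by decide)
  have d134 := hχ 1 3 4 (by decide) (by decide) (by decide)
  have d234 := hχ 2 3 4 (by decide) (by decide) (by decide)
  have e0 : (q0 : ℂ) = det3 (χ 0) (χ 1) (χ 3) * det3 (χ 1) (χ 2) (χ 4) /
      (det3 (χ 1) (χ 2) (χ 3) * det3 (χ 0) (χ 1) (χ 4)) := by
    rw [← hq0, ← neg_div_neg_eq]
    congr 1 <;> simp only [det3_eq] <;> ring
  have e1 : (q1 : ℂ) = det3 (χ 0) (χ 1) (χ 3) * det3 (χ 0) (χ 2) (χ 4) /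
      (det3 (χ 0) (χ 2) (χ 3) * det3 (χ 0) (χ 1) (χ 4)) := by
    rw [← hq1, crossRatio]
    congr 1 <;> simp only [det3_eq] <;> ring
  have x0 : (q0 : ℂ) - 1 = det3 (χ 0) (χ 1) (χ 2) * det3 (χ 1) (χ 3) (χ 4) /
      (det3 (χ 1) (χ 2) (χ 3) * det3 (χ 0) (χ 1) (χ 4)) := by
    rw [e0, div_sub_one (mul_ne_zero d123 d014)]
    congr 1
    simp only [det3_eq]
    ring
  have x1 : (q1 : ℂ) - 1 = det3 (χ 0) (χ 1) (χ 2) * det3 (χ 0) (χ 3) (χ 4) /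
      (det3 (χ 0) (χ 2) (χ 3) * det3 (χ 0) (χ 1) (χ 4)) := by
    rw [e1, div_sub_one (mul_ne_zero d023 d014)]
    congr 1
    simp only [det3_eq]
    ring
  have x01 : (q0 : ℂ) - q1 = det3 (χ 0) (χ 1) (χ 3) * det3 (χ 0) (χ 1) (χ 2) *
      det3 (χ 2) (χ 3) (χ 4) /
      (det3 (χ 1) (χ 2) (χ 3) * det3 (χ 0) (χ 2) (χ 3) * det3 (χ 0) (χ 1) (χ 4)) := by
    have : det3 (χ 1) (χ 2) (χ 4) * det3 (χ 0) (χ 2) (χ 3) -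
        det3 (χ 0) (χ 2) (χ 4) * det3 (χ 1) (χ 2) (χ 3) =
        det3 (χ 0) (χ 1) (χ 2) * det3 (χ 2) (χ 3) (χ 4) := by
      simp only [det3_eq]
      ring
    rw [e0, e1, mul_assoc (det3 (χ 0) (χ 1) (χ 3)), ← this]
    field_simp
  refine exists_conicParam_of_coords (a0 := det3 (χ 1) (χ 2) (χ 3) / det3 (χ 0) (χ 1) (χ 2))
    (a1 := -det3 (χ 0) (χ 2) (χ 3) / det3 (χ 0) (χ 1) (χ 2))
    (a2 := det3 (χ 0) (χ 1) (χ 3) / det3 (χ 0) (χ 1) (χ 2))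
    (c0 := det3 (χ 0) (χ 1) (χ 4) / det3 (χ 0) (χ 1) (χ 3)) (q0 := q0) (q1 := q1)
    (div_ne_zero d123 d012) (div_ne_zero (neg_ne_zero.2 d023) d012) (div_ne_zero d013 d012)
    (div_ne_zero d014 d013) ?_ ?_ ?_ ?_ ?_ ?_ ?_
  · rw [← Complex.ofReal_ne_zero, e0]
    exact div_ne_zero (mul_ne_zero d013 d124) (mul_ne_zero d123 d014)
  · rw [← Complex.ofReal_ne_zero, e1]
    exact div_ne_zero (mul_ne_zero d013 d024) (mul_ne_zero d023 d014)
  · rw [← sub_ne_zero, ← Complex.ofReal_ne_zero, Complex.ofReal_sub, x01]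
    exact div_ne_zero (mul_ne_zero (mul_ne_zero d013 d012) d234)
      (mul_ne_zero (mul_ne_zero d123 d023) d014)
  · rw [← sub_ne_zero, ← Complex.ofReal_ne_zero, Complex.ofReal_sub, Complex.ofReal_one, x0]
    exact div_ne_zero (mul_ne_zero d012 d134) (mul_ne_zero d123 d014)
  · rw [← sub_ne_zero, ← Complex.ofReal_ne_zero, Complex.ofReal_sub, Complex.ofReal_one, x1]
    exact div_ne_zero (mul_ne_zero d012 d034) (mul_ne_zero d023 d014)
  · exact eq_combination d012 (χ 3)
  · rw [e0, e1]
    refine (eq_combination d012 (χ 4)).trans ?_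
    congr 2
    · congr 1
      field_simp
    · congr 1
      field_simp
    · field_simp

namespace IsConicParam

variable {χ : Fin 5 → Fin 3 → ℂ} {t : Fin 5 → ℝ} {w : Fin 5 → ℂ} {c : ℂ}

lemma weight_ne_zero (h : IsConicParam χ t w c) (hχ : GenPos χ) (i : Fin 5) : w i ≠ 0 := by
  obtain ⟨j, k, hij, hik, hjk⟩ : ∃ j k, i ≠ j ∧ i ≠ k ∧ j ≠ k := by
    revert i; decide
  intro h0
  exact hχ i j k hij hik hjk (by rw [h, h0]; ring)

lemma const_ne_zero (h : IsConicParam χ t w c) (hχ : GenPos χ) : c ≠ 0 := by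
  intro h0
  exact hχ 0 1 2 (by decide) (by decide) (by decide) (by rw [h, h0]; ring)

lemma sub_ne_zero (h : IsConicParam χ t w c) (hχ : GenPos χ) {i j : Fin 5} (hij : i ≠ j) :
    (t j : ℂ) - t i ≠ 0 := by
  obtain ⟨k, hik, hjk⟩ : ∃ k, i ≠ k ∧ j ≠ k := by
    clear h hχ; revert i j; decide
  intro h0
  exact hχ i j k hij hik hjk (by rw [h, h0]; ring)

lemma injective (h : IsConicParam χ t w c) (hχ : GenPos χ) : Function.Injective t := by
  intro i j hij
  by_contra hne
  exact h.sub_ne_zero hχ hne (by rw [hij, sub_self])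

end IsConicParam

/-- The cross-ratio of the real numbers `x a`, `x b`, `x m`, `x d`. -/
noncomputable def realCrossRatio (x : Fin 5 → ℝ) (a m b d : Fin 5) : ℝ :=
  ((x m - x a) * (x d - x b)) / ((x m - x b) * (x d - x a))

lemma realCrossRatio_comp (x : Fin 5 → ℝ) (κ : Equiv.Perm (Fin 5)) (a m b d : Fin 5) :
    realCrossRatio (x ∘ κ) a m b d = realCrossRatio x (κ a) (κ m) (κ b) (κ d) := rfl

namespace IsGram

variable {φ ψ : Fin 5 → Fin 3 → ℂ} {G : Fin 5 → Fin 5 → Fin 5 → Fin 5 → ℂ}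
  {t u : Fin 5 → ℝ} {w z : Fin 5 → ℂ} {c d : ℂ}

lemma right_ratio_param (h : IsGram φ ψ G) (hq : IsConicParam ψ u z d) {i k : Fin 5}
    (hik : i ≠ k) (j l l' : Fin 5) :
    G i j k l * (z l' * (u l' - u i) * (u l' - u k)) =
      G i j k l' * (z l * (u l - u i) * (u l - u k)) := by
  have h1 := h.right_ratio i j k l l'
  rw [hq, hq] at h1
  have hψ := h.right_genPos
  have hne : d * z i * z k * ((u k : ℂ) - u i) ≠ 0 :=
    mul_ne_zero (mul_ne_zero (mul_ne_zero (hq.const_ne_zero hψ) (hq.weight_ne_zero hψ i))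
      (hq.weight_ne_zero hψ k)) (hq.sub_ne_zero hψ hik)
  exact mul_left_cancel₀ hne (by linear_combination h1)

lemma left_ratio_param (h : IsGram φ ψ G) (hp : IsConicParam φ t w c) {j l : Fin 5}
    (hjl : j ≠ l) (i k k' : Fin 5) :
    G i j k l * (w k' * (t k' - t j) * (t k' - t l)) =
      G i j k' l * (w k * (t k - t j) * (t k - t l)) :=
  h.swap.right_ratio_param hp hjl i k k'

lemma diag_eq (h : IsGram φ ψ G) (hp : IsConicParam φ t w c) (hq : IsConicParam ψ u z d) :
    G 0 1 0 1 * (w 2 * z 3 * (t 2 - t 1) * (t 2 - t 3) * (u 3 - u 0) * (u 3 - u 2)) =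
      G 0 1 2 3 * (w 0 * z 1 * (t 0 - t 1) * (t 0 - t 3) * (u 1 - u 0) * (u 1 - u 2)) *
        (1 - realCrossRatio t 3 4 2 0 * realCrossRatio u 2 4 3 1 : ℝ) := by
  have hφ := h.left_genPos
  have hψ := h.right_genPos
  have b1 := h.left_ratio_param hp (show (1 : Fin 5) ≠ 3 by decide) 0 0 2
  have b2 := h.left_ratio_param hp (show (1 : Fin 5) ≠ 2 by decide) 0 0 3
  have b3 := h.right_ratio_param hq (show (0 : Fin 5) ≠ 3 by decide) 1 2 4
  have b4 := h.left_ratio_param hp (show (1 : Fin 5) ≠ 4 by decide) 0 3 2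
  have b5 := h.right_ratio_param hq (show (0 : Fin 5) ≠ 2 by decide) 1 4 3
  have e := h.diag_expansion
  rw [hq, hq, hq] at e
  have D {i j : Fin 5} (hij : i ≠ j) := hp.sub_ne_zero hφ hij
  have E {i j : Fin 5} (hij : i ≠ j) := hq.sub_ne_zero hψ hij
  have W := hp.weight_ne_zero hφ
  have Z := hq.weight_ne_zero hψ
  have hd := hq.const_ne_zero hψ
  have b6 : G 0 1 0 2 * ((t 3 - t 2) * (u 4 - u 3) * w 2 * (t 2 - t 1) * (t 2 - t 4) * z 3 *
      (u 3 - u 0)) = -(G 0 1 2 3 * (w 0 * (t 0 - t 1) * (t 0 - t 2) * z 2 * (u 2 - u 0) *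
      (t 3 - t 4) * (u 4 - u 2))) := by
    have hne : w 3 * z 4 * (t 3 - t 1) * (u 4 - u 0) * (u 3 - u 2) ≠ 0 :=
      mul_ne_zero (mul_ne_zero (mul_ne_zero (mul_ne_zero (W 3) (Z 4)) (D (by decide)))
        (E (by decide))) (E (by decide))
    refine mul_left_cancel₀ hne ?_
    linear_combination
      (z 4 * (u 4 - u 0) * (u 4 - u 3)) * (w 2 * (t 2 - t 1) * (t 2 - t 4)) *
        (z 3 * (u 3 - u 0) * (u 3 - u 2)) * b2 +
      (w 0 * (t 0 - t 1) * (t 0 - t 2)) * (w 2 * (t 2 - t 1) * (t 2 - t 4)) *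
        (z 3 * (u 3 - u 0) * (u 3 - u 2)) * b3 +
      (w 0 * (t 0 - t 1) * (t 0 - t 2)) * (z 2 * (u 2 - u 0) * (u 2 - u 3)) *
        (z 3 * (u 3 - u 0) * (u 3 - u 2)) * b4 +
      (w 0 * (t 0 - t 1) * (t 0 - t 2)) * (z 2 * (u 2 - u 0) * (u 2 - u 3)) *
        (w 3 * (t 3 - t 1) * (t 3 - t 4)) * b5
  have key : G 0 1 0 1 * (w 2 * z 3 * (t 2 - t 1) * (t 2 - t 3) * (u 3 - u 0) * (u 3 - u 2)) *
      ((t 4 - t 2) * (u 4 - u 3)) = G 0 1 2 3 * (w 0 * z 1 * (t 0 - t 1) * (u 1 - u 0)) *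
        ((t 4 - t 2) * (t 0 - t 3) * (u 4 - u 3) * (u 1 - u 2) -
          (t 4 - t 3) * (t 0 - t 2) * (u 4 - u 2) * (u 1 - u 3)) := by
    have hne : d * z 0 * z 2 * (u 2 - u 0) ≠ 0 :=
      mul_ne_zero (mul_ne_zero (mul_ne_zero hd (Z 0)) (Z 2)) (E (by decide))
    refine mul_left_cancel₀ hne ?_
    linear_combination (w 2 * (t 2 - t 1) * (t 2 - t 3) * (t 4 - t 2) * (u 4 - u 3)) * e +
      d * z 0 * (z 1 * (u 1 - u 0) * (u 3 - u 1)) * b6 +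
      d * z 0 * (z 1 * z 2 * (u 1 - u 0) * (u 2 - u 0) * (u 1 - u 2) * (t 4 - t 2) *
        (u 4 - u 3)) * b1
  have h1 : ((t 4 - t 2) * (u 4 - u 3) : ℂ) ≠ 0 := mul_ne_zero (D (by decide)) (E (by decide))
  have h2 : (t 4 - t 2 : ℂ) ≠ 0 := D (by decide)
  have h3 : (u 4 - u 3 : ℂ) ≠ 0 := E (by decide)
  have h4 : (t 0 - t 3 : ℂ) ≠ 0 := D (by decide)
  have h5 : (u 1 - u 2 : ℂ) ≠ 0 := E (by decide)
  refine mul_right_cancel₀ h1 (key.trans ?_)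
  simp only [realCrossRatio]
  push_cast
  field_simp

lemma diag_mul_diag (h : IsGram φ ψ G) (hp : IsConicParam φ t w c) (hq : IsConicParam ψ u z d) :
    G 0 1 0 1 * G 2 3 2 3 = G 0 1 2 3 * G 2 3 0 1 *
      ((1 - realCrossRatio t 3 4 2 0 * realCrossRatio u 2 4 3 1) *
        (1 - realCrossRatio t 1 4 0 2 * realCrossRatio u 0 4 1 3) : ℝ) := by
  have hφ := h.left_genPos
  have hψ := h.right_genPos
  have D {i j : Fin 5} (hij : i ≠ j) := hp.sub_ne_zero hφ hij
  have E {i j : Fin 5} (hij : i ≠ j) := hq.sub_ne_zero hψ hij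
  have W := hp.weight_ne_zero hφ
  have Z := hq.weight_ne_zero hψ
  have e1 := h.diag_eq hp hq
  let κ : Equiv.Perm (Fin 5) := (Equiv.swap 0 2).trans (Equiv.swap 1 3)
  have e2 := (h.comp κ).diag_eq (hp.comp κ) (hq.comp κ)
  simp only [realCrossRatio_comp, Function.comp_apply, show κ 0 = 2 by decide,
    show κ 1 = 3 by decide, show κ 2 = 0 by decide, show κ 3 = 1 by decide,
    show κ 4 = 4 by decide] at e2
  have hne : (w 2 * z 3 * (t 2 - t 1) * (t 2 - t 3) * (u 3 - u 0) * (u 3 - u 2)) *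
      (w 0 * z 1 * (t 0 - t 3) * (t 0 - t 1) * (u 1 - u 2) * (u 1 - u 0)) ≠ 0 := by
    refine mul_ne_zero ?_ ?_ <;>
    exact mul_ne_zero (mul_ne_zero (mul_ne_zero (mul_ne_zero (mul_ne_zero (W _) (Z _))
      (D (by decide))) (D (by decide))) (E (by decide))) (E (by decide))
  refine mul_right_cancel₀ hne ?_
  rw [Complex.ofReal_mul, mul_mul_mul_comm, e1, e2]
  ring

lemma one_le_mul (h : IsGram φ ψ G) (hp : IsConicParam φ t w c) (hq : IsConicParam ψ u z d) :
    1 ≤ (1 - realCrossRatio t 3 4 2 0 * realCrossRatio u 2 4 3 1) *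
        (1 - realCrossRatio t 1 4 0 2 * realCrossRatio u 0 4 1 3) := by
  have h1 := h.cauchy_schwarz 0 1 2 3
  rw [h.diag_mul_diag hp hq, ← h.herm 0 1 2 3, Complex.mul_conj] at h1
  have h2 : 0 < Complex.normSq (G 0 1 2 3) := Complex.normSq_pos.2 h.offDiag_ne_zero
  rw [← Complex.ofReal_mul, ← Complex.ofReal_sub, Complex.zero_le_real] at h1
  nlinarith

lemma one_le_mul_perm (h : IsGram φ ψ G) (hp : IsConicParam φ t w c)
    (hq : IsConicParam ψ u z d) (κ : Equiv.Perm (Fin 5)) :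
    1 ≤ (1 - realCrossRatio t (κ 3) (κ 4) (κ 2) (κ 0) *
          realCrossRatio u (κ 2) (κ 4) (κ 3) (κ 1)) *
        (1 - realCrossRatio t (κ 1) (κ 4) (κ 0) (κ 2) *
          realCrossRatio u (κ 0) (κ 4) (κ 1) (κ 3)) :=
  (h.comp κ).one_le_mul (hp.comp κ) (hq.comp κ)

lemma exists_conicParams (h : IsGram φ ψ G) :
    (∃ t w c, IsConicParam φ t w c) ∧ ∃ u z d, IsConicParam ψ u z d :=
  ⟨exists_conicParam h.left_genPos h.swap.conj_crossRatio
      (h.swap.comp (Equiv.swap 0 1)).conj_crossRatio,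
    exists_conicParam h.right_genPos h.conj_crossRatio
      (h.comp (Equiv.swap 0 1)).conj_crossRatio⟩

end IsGram

/-- The sign of `realCrossRatio` on a sequence ordered like `s`. -/
def CrossRatioPos (s : Fin 5 → Fin 5) (a m b d : Fin 5) : Prop :=
  ((s a < s m ↔ s b < s d) ↔ s b < s m) ↔ s a < s d

instance (s : Fin 5 → Fin 5) (a m b d : Fin 5) : Decidable (CrossRatioPos s a m b d) := by
  unfold CrossRatioPos; infer_instance

/-- The relative order of the points of the two conics violates the inequality of
`IsGram.one_le_mul_perm`, the first sequence being increasing. -/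
def OrderViolation (s κ : Fin 5 → Fin 5) : Prop :=
  ((CrossRatioPos id (κ 3) (κ 4) (κ 2) (κ 0) ↔ CrossRatioPos s (κ 2) (κ 4) (κ 3) (κ 1)) ∧
    CrossRatioPos id (κ 1) (κ 4) (κ 0) (κ 2) ∧ CrossRatioPos id (κ 2) (κ 4) (κ 0) (κ 1) ∧
    CrossRatioPos s (κ 0) (κ 4) (κ 1) (κ 3) ∧ CrossRatioPos s (κ 3) (κ 4) (κ 1) (κ 0)) ∨
  (¬ (CrossRatioPos id (κ 3) (κ 4) (κ 2) (κ 0) ↔ CrossRatioPos s (κ 2) (κ 4) (κ 3) (κ 1)) ∧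
    ¬ CrossRatioPos id (κ 2) (κ 4) (κ 0) (κ 1) ∧ ¬ CrossRatioPos s (κ 3) (κ 4) (κ 1) (κ 0))

instance (s κ : Fin 5 → Fin 5) : Decidable (OrderViolation s κ) := by
  unfold OrderViolation; infer_instance

set_option maxRecDepth 100000 in
lemma order_dichotomy : ∀ s : Equiv.Perm (Fin 5),
    (¬ CrossRatioPos s 1 3 2 4 ∧ ¬ CrossRatioPos s 0 2 4 3) ∨
      OrderViolation s ![0, 1, 2, 4, 3] ∨ OrderViolation s ![1, 0, 4, 2, 3] ∨
      OrderViolation s ![0, 4, 1, 3, 2] ∨ OrderViolation s ![0, 2, 4, 1, 3] ∨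
      OrderViolation s ![2, 1, 0, 3, 4] ∨ OrderViolation s ![3, 0, 2, 4, 1] := by
  decide +kernel

lemma mul_pos_iff_iff {p q : ℝ} (hp : p ≠ 0) (hq : q ≠ 0) : 0 < p * q ↔ (0 < p ↔ 0 < q) := by
  rcases lt_or_gt_of_ne hp with h | h <;> rcases lt_or_gt_of_ne hq with h' | h'
  · simp [mul_pos_of_neg_of_neg h h', h.not_gt, h'.not_gt]
  · simp [(mul_neg_of_neg_of_pos h h').not_gt, h.not_gt, h']
  · simp [(mul_neg_of_pos_of_neg h h').not_gt, h, h'.not_gt]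
  · simp [mul_pos h h', h, h']

lemma realCrossRatio_pos_iff {x : Fin 5 → ℝ} {s : Fin 5 → Fin 5}
    (hx : ∀ a b, x a < x b ↔ s a < s b) {a m b d : Fin 5} (ham : x a ≠ x m) (hbd : x b ≠ x d)
    (hbm : x b ≠ x m) (had : x a ≠ x d) :
    0 < realCrossRatio x a m b d ↔ CrossRatioPos s a m b d := by
  have h1 := sub_ne_zero.2 ham.symm
  have h2 := sub_ne_zero.2 hbd.symm
  have h3 := sub_ne_zero.2 hbm.symm
  have h4 := sub_ne_zero.2 had.symm
  rw [realCrossRatio, div_eq_mul_inv, mul_inv, ← mul_assoc,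
    mul_pos_iff_iff (mul_ne_zero (mul_ne_zero h1 h2) (inv_ne_zero h3)) (inv_ne_zero h4),
    mul_pos_iff_iff (mul_ne_zero h1 h2) (inv_ne_zero h3), mul_pos_iff_iff h1 h2]
  simp only [inv_pos, sub_pos, hx, CrossRatioPos]

lemma realCrossRatio_ne_zero {x : Fin 5 → ℝ} {a m b d : Fin 5} (ham : x a ≠ x m)
    (hbd : x b ≠ x d) (hbm : x b ≠ x m) (had : x a ≠ x d) : realCrossRatio x a m b d ≠ 0 :=
  div_ne_zero (mul_ne_zero (sub_ne_zero.2 ham.symm) (sub_ne_zero.2 hbd.symm))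
    (mul_ne_zero (sub_ne_zero.2 hbm.symm) (sub_ne_zero.2 had.symm))

lemma one_sub_realCrossRatio {x : Fin 5 → ℝ} {a m b d : Fin 5} (hbm : x b ≠ x m)
    (had : x a ≠ x d) : 1 - realCrossRatio x a m b d = realCrossRatio x d m b a := by
  have h3 := sub_ne_zero.2 hbm.symm
  have h4 := sub_ne_zero.2 had.symm
  have h5 := sub_ne_zero.2 had
  simp only [realCrossRatio]
  field_simp
  ring

lemma not_one_le_of_orderViolation {t u : Fin 5 → ℝ} {s κ : Fin 5 → Fin 5}
    (ht : StrictMono t) (hu : Function.Injective u) (hs : ∀ a b, u a < u b ↔ s a < s b)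
    (hκ : Function.Injective κ) (h : OrderViolation s κ) :
    ¬ 1 ≤ (1 - realCrossRatio t (κ 3) (κ 4) (κ 2) (κ 0) *
          realCrossRatio u (κ 2) (κ 4) (κ 3) (κ 1)) *
        (1 - realCrossRatio t (κ 1) (κ 4) (κ 0) (κ 2) *
          realCrossRatio u (κ 0) (κ 4) (κ 1) (κ 3)) := by
  have hid : ∀ a b, t a < t b ↔ (id a : Fin 5) < id b := fun a b => ht.lt_iff_lt
  have T {a b : Fin 5} (hab : a ≠ b) : t (κ a) ≠ t (κ b) := ht.injective.ne (hκ.ne hab)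
  have U {a b : Fin 5} (hab : a ≠ b) : u (κ a) ≠ u (κ b) := hu.ne (hκ.ne hab)
  have ht' {a m b d : Fin 5} (h1 : a ≠ m) (h2 : b ≠ d) (h3 : b ≠ m) (h4 : a ≠ d) :=
    realCrossRatio_pos_iff hid (T h1) (T h2) (T h3) (T h4)
  have hu' {a m b d : Fin 5} (h1 : a ≠ m) (h2 : b ≠ d) (h3 : b ≠ m) (h4 : a ≠ d) :=
    realCrossRatio_pos_iff hs (U h1) (U h2) (U h3) (U h4)
  have nα : realCrossRatio t (κ 3) (κ 4) (κ 2) (κ 0) ≠ 0 := realCrossRatio_ne_zero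
    (T (by decide)) (T (by decide)) (T (by decide)) (T (by decide))
  have nβ : realCrossRatio u (κ 2) (κ 4) (κ 3) (κ 1) ≠ 0 := realCrossRatio_ne_zero
    (U (by decide)) (U (by decide)) (U (by decide)) (U (by decide))
  rw [OrderViolation,
    ← ht' (by decide) (by decide) (by decide) (by decide),
    ← ht' (by decide) (by decide) (by decide) (by decide),
    ← ht' (by decide) (by decide) (by decide) (by decide),
    ← hu' (by decide) (by decide) (by decide) (by decide),
    ← hu' (by decide) (by decide) (by decide) (by decide),
    ← hu' (by decide) (by decide) (by decide) (by decide),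
    ← one_sub_realCrossRatio (a := κ 1) (b := κ 0) (T (by decide)) (T (by decide)),
    ← one_sub_realCrossRatio (a := κ 0) (b := κ 1) (U (by decide)) (U (by decide)),
    ← mul_pos_iff_iff nα nβ] at h
  generalize realCrossRatio t (κ 3) (κ 4) (κ 2) (κ 0) *
    realCrossRatio u (κ 2) (κ 4) (κ 3) (κ 1) = X at *
  generalize realCrossRatio t (κ 1) (κ 4) (κ 0) (κ 2) = α at *
  generalize realCrossRatio u (κ 0) (κ 4) (κ 1) (κ 3) = β at *
  rw [not_le]
  rcases h with ⟨hX, h1, h2, h3, h4⟩ | ⟨hX, h2, h4⟩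
  · have h5 : α * β < 1 := by nlinarith
    have h6 : 0 < α * β := mul_pos h1 h3
    nlinarith
  · rw [not_lt] at hX h2 h4
    have h5 : 1 ≤ α * β := by nlinarith
    nlinarith

lemma realCrossRatio_neg_of_inequality {t u : Fin 5 → ℝ} (ht : StrictMono t)
    (hu : Function.Injective u)
    (h : ∀ κ : Equiv.Perm (Fin 5), 1 ≤ (1 - realCrossRatio t (κ 3) (κ 4) (κ 2) (κ 0) *
          realCrossRatio u (κ 2) (κ 4) (κ 3) (κ 1)) *
        (1 - realCrossRatio t (κ 1) (κ 4) (κ 0) (κ 2) *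
          realCrossRatio u (κ 0) (κ 4) (κ 1) (κ 3))) :
    realCrossRatio u 1 3 2 4 < 0 ∧ realCrossRatio u 0 2 4 3 < 0 := by
  let s : Equiv.Perm (Fin 5) := (Tuple.sort u).symm
  have hmono : StrictMono (u ∘ Tuple.sort u) :=
    (Tuple.monotone_sort u).strictMono_of_injective (hu.comp (Tuple.sort u).injective)
  have hs : ∀ a b, u a < u b ↔ s a < s b := by
    intro a b
    rw [← hmono.lt_iff_lt]
    simp [s]
  have no_violation (κ : Fin 5 → Fin 5) (hκ : Function.Injective κ) : ¬ OrderViolation s κ :=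
    fun hv => not_one_le_of_orderViolation ht hu hs hκ hv
      (h (Equiv.ofBijective κ (Finite.injective_iff_bijective.1 hκ)))
  have hneg {a m b d : Fin 5} (ham : a ≠ m) (hbd : b ≠ d) (hbm : b ≠ m) (had : a ≠ d)
      (hc : ¬ CrossRatioPos s a m b d) : realCrossRatio u a m b d < 0 := by
    rw [← realCrossRatio_pos_iff hs (hu.ne ham) (hu.ne hbd) (hu.ne hbm) (hu.ne had)] at hc
    exact lt_of_le_of_ne (not_lt.1 hc)
      (realCrossRatio_ne_zero (hu.ne ham) (hu.ne hbd) (hu.ne hbm) (hu.ne had))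
  rcases order_dichotomy s with ⟨h1, h2⟩ | hv | hv | hv | hv | hv | hv
  · exact ⟨hneg (by decide) (by decide) (by decide) (by decide) h1,
      hneg (by decide) (by decide) (by decide) (by decide) h2⟩
  all_goals exact absurd hv (no_violation _ (by decide))

namespace IsConicParam

variable {χ : Fin 5 → Fin 3 → ℂ} {t : Fin 5 → ℝ} {w : Fin 5 → ℂ} {c : ℂ}

lemma s1_eq (h : IsConicParam χ t w c) (hχ : GenPos χ) :
    s1 χ = (-realCrossRatio t 1 3 2 4 : ℝ) := by
  have D {i j : Fin 5} (hij : i ≠ j) := h.sub_ne_zero hχ hij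
  have d01 : (t 1 - t 0 : ℂ) ≠ 0 := D (by decide)
  have d02 : (t 2 - t 0 : ℂ) ≠ 0 := D (by decide)
  have d03 : (t 3 - t 0 : ℂ) ≠ 0 := D (by decide)
  have d04 : (t 4 - t 0 : ℂ) ≠ 0 := D (by decide)
  have d14 : (t 4 - t 1 : ℂ) ≠ 0 := D (by decide)
  have d23 : (t 3 - t 2 : ℂ) ≠ 0 := D (by decide)
  have hc := h.const_ne_zero hχ
  have w0 := h.weight_ne_zero hχ 0
  have w1 := h.weight_ne_zero hχ 1
  have w2 := h.weight_ne_zero hχ 2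
  have w3 := h.weight_ne_zero hχ 3
  have w4 := h.weight_ne_zero hχ 4
  simp only [s1, h _ _ _, realCrossRatio]
  push_cast
  field_simp

lemma s2_eq (h : IsConicParam χ t w c) (hχ : GenPos χ) :
    s2 χ = (-realCrossRatio t 0 2 4 3 : ℝ) := by
  have D {i j : Fin 5} (hij : i ≠ j) := h.sub_ne_zero hχ hij
  have d01 : (t 1 - t 0 : ℂ) ≠ 0 := D (by decide)
  have d03 : (t 3 - t 0 : ℂ) ≠ 0 := D (by decide)
  have d12 : (t 2 - t 1 : ℂ) ≠ 0 := D (by decide)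
  have d13 : (t 3 - t 1 : ℂ) ≠ 0 := D (by decide)
  have d14 : (t 4 - t 1 : ℂ) ≠ 0 := D (by decide)
  have d24 : (t 4 - t 2 : ℂ) ≠ 0 := D (by decide)
  have d42 : (t 2 - t 4 : ℂ) ≠ 0 := D (by decide)
  have hc := h.const_ne_zero hχ
  have w0 := h.weight_ne_zero hχ 0
  have w1 := h.weight_ne_zero hχ 1
  have w2 := h.weight_ne_zero hχ 2
  have w3 := h.weight_ne_zero hχ 3
  have w4 := h.weight_ne_zero hχ 4
  simp only [s2, h _ _ _, realCrossRatio]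
  push_cast
  field_simp
  ring

lemma isPosReal (h : IsConicParam χ t w c) (hχ : GenPos χ) (h1 : realCrossRatio t 1 3 2 4 < 0)
    (h2 : realCrossRatio t 0 2 4 3 < 0) : IsPosReal (s1 χ) ∧ IsPosReal (s2 χ) := by
  rw [h.s1_eq hχ, h.s2_eq hχ]
  exact ⟨⟨Complex.ofReal_im _, by simpa using h1⟩, ⟨Complex.ofReal_im _, by simpa using h2⟩⟩

end IsConicParam

/-- The relabelling which turns `s₁, s₂` into `s₃, s₄`. -/
def pentagramPerm : Equiv.Perm (Fin 5) where
  toFun := ![0, 2, 4, 1, 3]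
  invFun := ![0, 3, 1, 4, 2]
  left_inv := by decide
  right_inv := by decide

lemma s1_comp_pentagramPerm (ψ : Fin 5 → Fin 3 → ℂ) : s1 (ψ ∘ pentagramPerm) = s3 ψ := rfl

lemma s2_comp_pentagramPerm (ψ : Fin 5 → Fin 3 → ℂ) : s2 (ψ ∘ pentagramPerm) = s4 ψ := rfl

lemma IsGram.exists_perm {φ ψ : Fin 5 → Fin 3 → ℂ} {G : Fin 5 → Fin 5 → Fin 5 → Fin 5 → ℂ}
    (h : IsGram φ ψ G) : ∃ κ : Equiv.Perm (Fin 5),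
      IsPosReal (s1 (φ ∘ κ)) ∧ IsPosReal (s2 (φ ∘ κ)) ∧
      IsPosReal (s3 (ψ ∘ κ)) ∧ IsPosReal (s4 (ψ ∘ κ)) := by
  obtain ⟨⟨t, w, c, hp⟩, u, z, d, hq⟩ := h.exists_conicParams
  let σ := Tuple.sort t
  have ht : StrictMono (t ∘ σ) := (Tuple.monotone_sort t).strictMono_of_injective
    ((hp.injective h.left_genPos).comp σ.injective)
  have h' := h.comp σ
  have hp' := hp.comp σ
  have hq' := hq.comp σ
  obtain ⟨hu1, hu2⟩ := realCrossRatio_neg_of_inequality ht (hq'.injective h'.right_genPos)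
    (h'.one_le_mul_perm hp' hq')
  refine ⟨pentagramPerm.symm.trans σ, ?_⟩
  rw [← s1_comp_pentagramPerm, ← s2_comp_pentagramPerm, ← and_assoc]
  constructor
  · have hlt {i j : Fin 5} (hij : i < j) : 0 < t (σ j) - t (σ i) := sub_pos.2 (ht hij)
    refine (hp'.comp pentagramPerm.symm).isPosReal (h'.left_genPos.comp _) ?_ ?_
    · change ((t ∘ σ) 4 - (t ∘ σ) 3) * ((t ∘ σ) 2 - (t ∘ σ) 1) /
        (((t ∘ σ) 4 - (t ∘ σ) 1) * ((t ∘ σ) 2 - (t ∘ σ) 3)) < 0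
      exact div_neg_of_pos_of_neg (mul_pos (hlt (by decide)) (hlt (by decide)))
        (mul_neg_of_pos_of_neg (hlt (by decide)) (sub_neg.2 (ht (by decide))))
    · change ((t ∘ σ) 1 - (t ∘ σ) 0) * ((t ∘ σ) 4 - (t ∘ σ) 2) /
        (((t ∘ σ) 1 - (t ∘ σ) 2) * ((t ∘ σ) 4 - (t ∘ σ) 0)) < 0
      exact div_neg_of_pos_of_neg (mul_pos (hlt (by decide)) (hlt (by decide)))
        (mul_neg_of_neg_of_pos (sub_neg.2 (ht (by decide))) (hlt (by decide)))
  · have hcomp : (ψ ∘ (pentagramPerm.symm.trans σ)) ∘ pentagramPerm = ψ ∘ σ := by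
      ext i
      simp
    rw [hcomp]
    exact hq'.isPosReal h'.right_genPos hu1 hu2

lemma exists_orthogonal_frame_of_coords {a0 a1 a2 b0 b1 b2 : ℂ} {σ₁ σ₂ : ℝ} (ha0 : a0 ≠ 0)
    (ha1 : a1 ≠ 0) (ha2 : a2 ≠ 0) (h1 : 0 < σ₁) (h2 : 0 < σ₂)
    (e1 : σ₁ * (b2 * a1) = -(b1 * a2)) (e2 : (1 + σ₂) * (b0 * a2) = b2 * a0) :
    ∃ C : Matrix (Fin 3) (Fin 3) ℂ, C.det ≠ 0 ∧
      hinner (C.mulVec ![1, 0, 0]) (C.mulVec ![0, 1, 0]) = 0 ∧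
      hinner (C.mulVec ![0, 1, 0]) (C.mulVec ![0, 0, 1]) = 0 ∧
      hinner (C.mulVec ![0, 0, 1]) (C.mulVec ![a0, a1, a2]) = 0 ∧
      hinner (C.mulVec ![a0, a1, a2]) (C.mulVec ![b0, b1, b2]) = 0 ∧
      hinner (C.mulVec ![b0, b1, b2]) (C.mulVec ![1, 0, 0]) = 0 := by
  have c0 : conj a0 ≠ 0 := (map_ne_zero _).2 ha0
  have c1 : conj a1 ≠ 0 := (map_ne_zero _).2 ha1
  have n0 : 0 < ‖a0‖ := norm_pos_iff.2 ha0
  have n1 : 0 < ‖a1‖ := norm_pos_iff.2 ha1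
  have n2 : 0 < ‖a2‖ := norm_pos_iff.2 ha2
  let p : ℝ := ‖a2‖ / ‖a0‖ * Real.sqrt σ₂
  let q : ℝ := ‖a2‖ / ‖a1‖ * Real.sqrt (σ₂ / (σ₁ * (1 + σ₂)))
  have hp : 0 < p := by positivity
  have hq : 0 < q := by positivity
  have hp2 : (p : ℂ) ^ 2 * (a0 * conj a0) = a2 * conj a2 * σ₂ := by
    rw [Complex.mul_conj, Complex.mul_conj, Complex.normSq_eq_norm_sq, Complex.normSq_eq_norm_sq]
    norm_cast
    simp only [p, mul_pow, div_pow, Real.sq_sqrt h2.le]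
    field_simp
  have hq2 : (q : ℂ) ^ 2 * (a1 * conj a1) * (σ₁ * (1 + σ₂)) = a2 * conj a2 * σ₂ := by
    rw [Complex.mul_conj, Complex.mul_conj, Complex.normSq_eq_norm_sq, Complex.normSq_eq_norm_sq]
    norm_cast
    have : 0 ≤ σ₂ / (σ₁ * (1 + σ₂)) := by positivity
    simp only [q, mul_pow, div_pow, Real.sq_sqrt this]
    field_simp
  have s1 : (σ₁ : ℂ) ≠ 0 := by exact_mod_cast h1.ne'
  have s2 : (1 + σ₂ : ℂ) ≠ 0 := by exact_mod_cast (by positivity : (1 + σ₂ : ℝ) ≠ 0)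
  refine ⟨!![(p : ℂ), 0, 0; 0, q, 0; -a2 / a0, 0, 1], ?_, ?_, ?_, ?_, ?_, ?_⟩
  · simp [Matrix.det_fin_three, hp.ne', hq.ne']
  · simp [hinner, Fin.sum_univ_three, Matrix.mulVec, dotProduct]
  · simp [hinner, Fin.sum_univ_three, Matrix.mulVec, dotProduct]
  · simp [hinner, Fin.sum_univ_three, Matrix.mulVec, dotProduct]
    field_simp
    ring
  · simp [hinner, Fin.sum_univ_three, Matrix.mulVec, dotProduct]
    field_simp
    have k : (a1 * σ₁ * (1 + σ₂) : ℂ) ≠ 0 := mul_ne_zero (mul_ne_zero ha1 s1) s2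
    refine mul_left_cancel₀ k ?_
    linear_combination a1 * σ₁ * (1 + σ₂) * b0 * hp2 + b1 * a0 * hq2 +
      conj a2 * σ₂ * a1 * σ₁ * e2 + conj a2 * σ₂ * a0 * e1
  · simp [hinner, Fin.sum_univ_three, Matrix.mulVec, dotProduct]
    field_simp
    have e2c := congrArg conj e2
    simp only [map_mul, map_add, map_one, Complex.conj_ofReal] at e2c
    linear_combination conj b0 * hp2 + a2 * e2c

lemma exists_orthogonal_frame {χ : Fin 5 → Fin 3 → ℂ} (hχ : GenPos χ) (h1 : IsPosReal (s1 χ))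
    (h2 : IsPosReal (s2 χ)) : ∃ A : Matrix (Fin 3) (Fin 3) ℂ, A.det ≠ 0 ∧
      ∀ i, hinner (A.mulVec (χ i)) (A.mulVec (χ (i + 1))) = 0 := by
  have d012 := hχ 0 1 2 (by decide) (by decide) (by decide)
  have d013 := hχ 0 1 3 (by decide) (by decide) (by decide)
  have d014 := hχ 0 1 4 (by decide) (by decide) (by decide)
  have d023 := hχ 0 2 3 (by decide) (by decide) (by decide)
  have d123 := hχ 1 2 3 (by decide) (by decide) (by decide)
  have d124 := hχ 1 2 4 (by decide) (by decide) (by decide)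
  have e1 : s1 χ = ((s1 χ).re : ℂ) := Complex.ext rfl (by simpa using h1.1)
  have e2 : s2 χ = ((s2 χ).re : ℂ) := Complex.ext rfl (by simpa using h2.1)
  obtain ⟨C, hC, k01, k12, k23, k34, k40⟩ := exists_orthogonal_frame_of_coords
    (a0 := det3 (χ 1) (χ 2) (χ 3) / det3 (χ 0) (χ 1) (χ 2))
    (a1 := -det3 (χ 0) (χ 2) (χ 3) / det3 (χ 0) (χ 1) (χ 2))
    (a2 := det3 (χ 0) (χ 1) (χ 3) / det3 (χ 0) (χ 1) (χ 2))
    (b0 := det3 (χ 1) (χ 2) (χ 4) / det3 (χ 0) (χ 1) (χ 2))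
    (b1 := -det3 (χ 0) (χ 2) (χ 4) / det3 (χ 0) (χ 1) (χ 2))
    (b2 := det3 (χ 0) (χ 1) (χ 4) / det3 (χ 0) (χ 1) (χ 2))
    (div_ne_zero d123 d012) (div_ne_zero (neg_ne_zero.2 d023) d012) (div_ne_zero d013 d012)
    h1.2 h2.2
    (by
      rw [← e1, s1]
      field_simp)
    (by
      rw [← e2, s2]
      have : det3 (χ 0) (χ 1) (χ 3) * det3 (χ 1) (χ 2) (χ 4) -
          det3 (χ 0) (χ 1) (χ 2) * det3 (χ 1) (χ 3) (χ 4) =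
          det3 (χ 1) (χ 2) (χ 3) * det3 (χ 0) (χ 1) (χ 4) := by
        simp only [det3_eq]
        ring
      field_simp
      linear_combination this)
  let Φ : Matrix (Fin 3) (Fin 3) ℂ := Matrix.of fun i j => ![χ 0, χ 1, χ 2] j i
  have hΦ : IsUnit Φ.det := isUnit_iff_ne_zero.2 d012
  have hmul (x0 x1 x2 : ℂ) :
      (C * Φ⁻¹).mulVec (x0 • χ 0 + x1 • χ 1 + x2 • χ 2) = C.mulVec ![x0, x1, x2] := by
    have : x0 • χ 0 + x1 • χ 1 + x2 • χ 2 = Φ.mulVec ![x0, x1, x2] := by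
      ext i
      simp [Φ, Matrix.mulVec, dotProduct, Fin.sum_univ_three]
      ring
    rw [this, Matrix.mulVec_mulVec, Matrix.mul_assoc, Matrix.nonsing_inv_mul _ hΦ, Matrix.mul_one]
  have m0 := hmul 1 0 0
  have m1 := hmul 0 1 0
  have m2 := hmul 0 0 1
  simp only [one_smul, zero_smul, add_zero, zero_add] at m0 m1 m2
  have m3 := hmul _ _ _ ▸ congrArg (C * Φ⁻¹).mulVec (eq_combination d012 (χ 3))
  have m4 := hmul _ _ _ ▸ congrArg (C * Φ⁻¹).mulVec (eq_combination d012 (χ 4))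
  rw [← m0, ← m1] at k01
  rw [← m1, ← m2] at k12
  rw [← m2, ← m3] at k23
  rw [← m3, ← m4] at k34
  rw [← m4, ← m0] at k40
  refine ⟨C * Φ⁻¹, ?_, ?_⟩
  · rw [Matrix.det_mul]
    exact mul_ne_zero hC (Matrix.isUnit_nonsing_inv_det _ hΦ).ne_zero
  · intro i
    fin_cases i
    exacts [k01, k12, k23, k34, k40]

/-- The matrix whose columns are the product vectors `α i ⊗ β i`. -/
noncomputable def prodVecMatrix (α β : Fin 5 → Fin 3 → ℂ) : Matrix (Fin 3 × Fin 3) (Fin 5) ℂ :=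
  Matrix.of fun p i => prodVec (α i) (β i) p

/-- The families `α`, `β` consist of unit vectors and `α i ⊗ β i` are pairwise orthogonal. -/
structure IsProductOrthonormal (α β : Fin 5 → Fin 3 → ℂ) : Prop where
  left (i) : hinner (α i) (α i) = 1
  right (i) : hinner (β i) (β i) = 1
  orth (i j) : i ≠ j → hinner (α i) (α j) = 0 ∨ hinner (β i) (β j) = 0

lemma hinner_conj {α : Type*} [Fintype α] (x y : α → ℂ) :
    hinner (fun a => conj (x a)) (fun a => conj (y a)) = conj (hinner x y) := by
  simp [hinner]

lemma hinner_symm {α : Type*} [Fintype α] (x y : α → ℂ) : conj (hinner x y) = hinner y x := by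
  simp [hinner, mul_comm]

lemma IsProductOrthonormal.conj_left {α β : Fin 5 → Fin 3 → ℂ} (h : IsProductOrthonormal α β) :
    IsProductOrthonormal (fun i a => conj (α i a)) β where
  left i := by rw [hinner_conj, h.left, map_one]
  right := h.right
  orth i j hij := by
    rw [hinner_conj, map_eq_zero]
    exact h.orth i j hij

lemma IsProductOrthonormal.gram_eq_one {α β : Fin 5 → Fin 3 → ℂ}
    (h : IsProductOrthonormal α β) :
    (prodVecMatrix α β).conjTranspose * prodVecMatrix α β = 1 := by
  ext i j
  have : ((prodVecMatrix α β).conjTranspose * prodVecMatrix α β) i j =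
      hinner (prodVec (α i) (β i)) (prodVec (α j) (β j)) := by
    simp [Matrix.mul_apply, hinner, prodVecMatrix]
  rw [this, hinner_prodVec]
  by_cases hij : i = j
  · subst hij
    simp [h.left, h.right]
  · rw [Matrix.one_apply_ne hij]
    rcases h.orth i j hij with h0 | h0 <;> simp [h0]

/-- The orthogonal projection onto the complement of the span of the `α i ⊗ β i`, when these are
orthonormal. -/
noncomputable def complementProj (α β : Fin 5 → Fin 3 → ℂ) :
    Matrix (Fin 3 × Fin 3) (Fin 3 × Fin 3) ℂ :=
  1 - prodVecMatrix α β * (prodVecMatrix α β).conjTranspose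

lemma IsProductOrthonormal.complementProj_mul {α β : Fin 5 → Fin 3 → ℂ}
    (h : IsProductOrthonormal α β) : complementProj α β * prodVecMatrix α β = 0 := by
  rw [complementProj, Matrix.sub_mul, Matrix.mul_assoc, h.gram_eq_one, Matrix.one_mul,
    Matrix.mul_one, sub_self]

lemma IsProductOrthonormal.posSemidef_complementProj {α β : Fin 5 → Fin 3 → ℂ}
    (h : IsProductOrthonormal α β) : (complementProj α β).PosSemidef := by
  have hh : (complementProj α β).conjTranspose = complementProj α β := by
    simp [complementProj]
  have : complementProj α β = (complementProj α β).conjTranspose * complementProj α β := by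
    rw [hh]
    nth_rewrite 3 [complementProj]
    rw [Matrix.mul_sub, ← Matrix.mul_assoc, h.complementProj_mul, Matrix.zero_mul, sub_zero,
      Matrix.mul_one]
  rw [this]
  exact Matrix.posSemidef_conjTranspose_mul_self _

lemma IsProductOrthonormal.rank_complementProj {α β : Fin 5 → Fin 3 → ℂ}
    (h : IsProductOrthonormal α β) : (complementProj α β).rank = 4 := by
  have hV : (prodVecMatrix α β).rank = 5 := by
    rw [← Matrix.rank_conjTranspose_mul_self, h.gram_eq_one, Matrix.rank_one, Fintype.card_fin]
  have hker : LinearMap.ker (complementProj α β).mulVecLin =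
      LinearMap.range (prodVecMatrix α β).mulVecLin := by
    apply le_antisymm
    · intro v hv
      have hv' : (complementProj α β).mulVec v = 0 := hv
      rw [complementProj, Matrix.sub_mulVec, Matrix.one_mulVec, sub_eq_zero,
        ← Matrix.mulVec_mulVec] at hv'
      exact ⟨_, hv'.symm⟩
    · rintro _ ⟨w, rfl⟩
      change (complementProj α β).mulVec ((prodVecMatrix α β).mulVec w) = 0
      rw [Matrix.mulVec_mulVec, h.complementProj_mul, Matrix.zero_mulVec]
  have := (complementProj α β).mulVecLin.finrank_range_add_finrank_ker
  rw [hker] at this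
  simp only [Module.finrank_fintype_fun_eq_card, Fintype.card_prod, Fintype.card_fin] at this
  unfold Matrix.rank at hV ⊢
  omega

/-- The congruence transform by `A ⊗ B` of the complementary projection. -/
noncomputable def transformedProj (A B : Matrix (Fin 3) (Fin 3) ℂ) (α β : Fin 5 → Fin 3 → ℂ) :
    Matrix (Fin 3 × Fin 3) (Fin 3 × Fin 3) ℂ :=
  (Matrix.kroneckerMap (· * ·) A B).conjTranspose * complementProj α β *
    Matrix.kroneckerMap (· * ·) A B

lemma IsProductOrthonormal.posSemidef_transformedProj {α β : Fin 5 → Fin 3 → ℂ}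
    (h : IsProductOrthonormal α β) (A B : Matrix (Fin 3) (Fin 3) ℂ) :
    (transformedProj A B α β).PosSemidef :=
  h.posSemidef_complementProj.conjTranspose_mul_mul_same _

lemma transformedProj_apply (A B : Matrix (Fin 3) (Fin 3) ℂ) (α β : Fin 5 → Fin 3 → ℂ)
    (p q : Fin 3 × Fin 3) : transformedProj A B α β p q =
      (∑ c, conj (A c p.1) * A c q.1) * (∑ d, conj (B d p.2) * B d q.2) -
      ∑ i, (∑ c, conj (A c p.1) * α i c) * (∑ d, conj (B d p.2) * β i d) *
        ((∑ c, conj (α i c) * A c q.1) * (∑ d, conj (β i d) * B d q.2)) := by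
  rw [transformedProj, complementProj, Matrix.mul_sub, Matrix.sub_mul, Matrix.sub_apply,
    Matrix.mul_one, ← Matrix.mul_assoc, Matrix.mul_assoc]
  congr 1
  · simp only [Matrix.mul_apply, Matrix.conjTranspose_apply, Matrix.kroneckerMap_apply,
      Fintype.sum_mul_sum, Fintype.sum_prod_type, star_mul', Complex.star_def]
    exact Finset.sum_congr rfl fun c _ => Finset.sum_congr rfl fun d _ => by ring
  · rw [Matrix.mul_apply]
    refine Finset.sum_congr rfl fun i _ => ?_
    congr 1 <;>
    · simp only [Matrix.mul_apply, Matrix.conjTranspose_apply, Matrix.kroneckerMap_apply,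
        Fintype.sum_mul_sum, Fintype.sum_prod_type, star_mul', Complex.star_def, prodVecMatrix,
        prodVec, Matrix.of_apply]
      exact Finset.sum_congr rfl fun c _ => Finset.sum_congr rfl fun d _ => by ring

lemma pt_transformedProj (A B : Matrix (Fin 3) (Fin 3) ℂ) (α β : Fin 5 → Fin 3 → ℂ) :
    pt (transformedProj A B α β) =
      transformedProj (A.map conj) B (fun i a => conj (α i a)) β := by
  ext p q
  simp only [pt, Matrix.of_apply, transformedProj_apply, Matrix.map_apply, Complex.conj_conj]
  congr 1
  · simp only [mul_comm]
  · refine Finset.sum_congr rfl fun i _ => ?_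
    simp only [mul_comm (A _ _), mul_comm (α _ _)]
    ring

lemma IsProductOrthonormal.rank_transformedProj {α β : Fin 5 → Fin 3 → ℂ}
    (h : IsProductOrthonormal α β) {A B : Matrix (Fin 3) (Fin 3) ℂ} (hA : A.det ≠ 0)
    (hB : B.det ≠ 0) : (transformedProj A B α β).rank = 4 := by
  have hM : IsUnit (Matrix.kroneckerMap (· * ·) A B).det := by
    rw [Matrix.det_kronecker, isUnit_iff_ne_zero]
    exact mul_ne_zero (pow_ne_zero _ hA) (pow_ne_zero _ hB)
  rw [transformedProj, Matrix.rank_mul_eq_left_of_isUnit_det _ _ hM,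
    Matrix.rank_mul_eq_right_of_isUnit_det _ _ (by rw [Matrix.det_conjTranspose]; exact hM.star),
    h.rank_complementProj]

lemma kronecker_mulVec_prodVec (A B : Matrix (Fin 3) (Fin 3) ℂ) (x y : Fin 3 → ℂ) :
    (Matrix.kroneckerMap (· * ·) A B).mulVec (prodVec x y) = prodVec (A.mulVec x) (B.mulVec y) := by
  ext p
  simp only [Matrix.mulVec, dotProduct, prodVec, Matrix.kroneckerMap_apply, Fintype.sum_mul_sum,
    Fintype.sum_prod_type]
  exact Finset.sum_congr rfl fun c _ => Finset.sum_congr rfl fun d _ => by ring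

lemma IsProductOrthonormal.transformedProj_mulVec {α β : Fin 5 → Fin 3 → ℂ}
    (h : IsProductOrthonormal α β) {A B : Matrix (Fin 3) (Fin 3) ℂ} {x y : Fin 3 → ℂ} {i : Fin 5}
    {a b : ℂ} (hx : A.mulVec x = a • α i) (hy : B.mulVec y = b • β i) :
    (transformedProj A B α β).mulVec (prodVec x y) = 0 := by
  have hcol : (complementProj α β).mulVec (prodVec (α i) (β i)) = 0 := by
    have : prodVec (α i) (β i) = (prodVecMatrix α β).mulVec (Pi.single i 1) := by
      ext p
      simp [prodVecMatrix]
    rw [this, Matrix.mulVec_mulVec, h.complementProj_mul, Matrix.zero_mulVec]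
  rw [transformedProj, ← Matrix.mulVec_mulVec, kronecker_mulVec_prodVec, hx, hy,
    prodVec_smul_left, prodVec_smul_right, ← Matrix.mulVec_mulVec, Matrix.mulVec_smul,
    Matrix.mulVec_smul, Matrix.mulVec_smul, hcol]
  simp

lemma exists_unit_smul {v : Fin 3 → ℂ} (hv : v ≠ 0) :
    ∃ (u : Fin 3 → ℂ) (r : ℂ), hinner u u = 1 ∧ r ≠ 0 ∧ v = r • u := by
  have key : hinner v v = ((∑ a, ‖v a‖ ^ 2 : ℝ) : ℂ) := by
    push_cast
    exact Finset.sum_congr rfl fun a _ => Complex.conj_mul' _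
  have hpos : 0 < ∑ a, ‖v a‖ ^ 2 := by
    obtain ⟨a, ha⟩ := Function.ne_iff.1 hv
    exact Finset.sum_pos' (fun _ _ => by positivity)
      ⟨a, Finset.mem_univ _, pow_pos (norm_pos_iff.2 ha) 2⟩
  set s := ∑ a, ‖v a‖ ^ 2
  have hs : ((Real.sqrt s : ℝ) : ℂ) ≠ 0 := by exact_mod_cast (Real.sqrt_pos.2 hpos).ne'
  have hss : ((Real.sqrt s : ℝ) : ℂ) ^ 2 = s := by
    rw [← Complex.ofReal_pow, Real.sq_sqrt hpos.le]
  refine ⟨(Real.sqrt s : ℂ)⁻¹ • v, (Real.sqrt s : ℂ), ?_, hs, by rw [smul_inv_smul₀ hs]⟩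
  have : hinner ((Real.sqrt s : ℂ)⁻¹ • v) ((Real.sqrt s : ℂ)⁻¹ • v) =
      ((Real.sqrt s : ℂ) ^ 2)⁻¹ * hinner v v := by
    simp only [hinner, Pi.smul_apply, smul_eq_mul, map_mul, map_inv₀, Complex.conj_ofReal,
      Finset.mul_sum]
    exact Finset.sum_congr rfl fun a _ => by ring
  rw [this, key, hss]
  exact inv_mul_cancel₀ (by exact_mod_cast hpos.ne')

lemma hinner_smul_smul {α : Type*} [Fintype α] (a b : ℂ) (x y : α → ℂ) :
    hinner (a • x) (b • y) = conj a * b * hinner x y := by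
  simp only [hinner, Pi.smul_apply, smul_eq_mul, map_mul, Finset.mul_sum]
  exact Finset.sum_congr rfl fun _ _ => by ring

lemma exists_ppt_of_orthogonal {φ ψ : Fin 5 → Fin 3 → ℂ} {A B : Matrix (Fin 3) (Fin 3) ℂ}
    (hφ : ∀ i, φ i ≠ 0) (hψ : ∀ i, ψ i ≠ 0) (hA : A.det ≠ 0) (hB : B.det ≠ 0)
    (h : ∀ i j, i ≠ j → hinner (A.mulVec (φ i)) (A.mulVec (φ j)) = 0 ∨
      hinner (B.mulVec (ψ i)) (B.mulVec (ψ j)) = 0) :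
    ∃ ρ : Matrix (Fin 3 × Fin 3) (Fin 3 × Fin 3) ℂ,
      ρ ≠ 0 ∧ ρ.PosSemidef ∧ (pt ρ).PosSemidef ∧ ρ.rank = 4 ∧
      ∀ i, ρ.mulVec (prodVec (φ i) (ψ i)) = 0 := by
  have hnz {A : Matrix (Fin 3) (Fin 3) ℂ} (hA : A.det ≠ 0) {v : Fin 3 → ℂ} (hv : v ≠ 0) :
      A.mulVec v ≠ 0 := fun h0 => hv (Matrix.eq_zero_of_mulVec_eq_zero hA h0)
  choose α a hα ha hφα using fun i => exists_unit_smul (hnz hA (hφ i))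
  choose β b hβ hb hψβ using fun i => exists_unit_smul (hnz hB (hψ i))
  have hαβ : IsProductOrthonormal α β := ⟨hα, hβ, fun i j hij => by
    have := h i j hij
    simpa only [hφα, hψβ, hinner_smul_smul, mul_eq_zero, map_eq_zero, ha, hb, false_or] using this⟩
  have hrank := hαβ.rank_transformedProj hA hB
  refine ⟨transformedProj A B α β, ?_, hαβ.posSemidef_transformedProj A B, ?_, hrank, fun i =>
    hαβ.transformedProj_mulVec (hφα i) (hψβ i)⟩
  · intro h0
    simp [h0] at hrank
  · rw [pt_transformedProj]
    exact hαβ.conj_left.posSemidef_transformedProj _ _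

lemma orthogonal_of_frames {x y : Fin 5 → Fin 3 → ℂ}
    (hx : ∀ i, hinner (x i) (x (i + 1)) = 0)
    (hy : ∀ i, hinner (y (pentagramPerm i)) (y (pentagramPerm (i + 1))) = 0) (i j : Fin 5)
    (hij : i ≠ j) : hinner (x i) (x j) = 0 ∨ hinner (y i) (y j) = 0 := by
  have hy' (k : Fin 5) : hinner (y k) (y (k + 2)) = 0 := by
    obtain ⟨l, rfl⟩ := pentagramPerm.surjective k
    have : pentagramPerm (l + 1) = pentagramPerm l + 2 := by
      revert l
      decide
    exact this ▸ hy l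
  have hcases : ∀ i j : Fin 5, i ≠ j → j = i + 1 ∨ i = j + 1 ∨ j = i + 2 ∨ i = j + 2 := by decide
  rcases hcases i j hij with rfl | rfl | rfl | rfl
  · exact Or.inl (hx i)
  · exact Or.inl (by rw [← hinner_symm, hx, map_zero])
  · exact Or.inr (hy' i)
  · exact Or.inr (by rw [← hinner_symm, hy', map_zero])

theorem stmt16 (φ ψ : Fin 5 → Fin 3 → ℂ)
    (hφ : ∀ i, φ i ≠ 0) (hψ : ∀ i, ψ i ≠ 0)
    (hgUPB : ¬ ∃ (f g : Fin 3 → ℂ), f ≠ 0 ∧ g ≠ 0 ∧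
      ∀ i, hinner (prodVec (φ i) (ψ i)) (prodVec f g) = 0) :
    (∃ ρ : Matrix (Fin 3 × Fin 3) (Fin 3 × Fin 3) ℂ,
      ρ ≠ 0 ∧ ρ.PosSemidef ∧ (pt ρ).PosSemidef ∧ ρ.rank = 4 ∧
      ∀ i, ρ.mulVec (prodVec (φ i) (ψ i)) = 0) ↔
      (∃ κ : Equiv.Perm (Fin 5),
        IsPosReal (s1 (φ ∘ κ)) ∧ IsPosReal (s2 (φ ∘ κ)) ∧
        IsPosReal (s3 (ψ ∘ κ)) ∧ IsPosReal (s4 (ψ ∘ κ))) := by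
  have gφ := genPos_left_of_unextendible hgUPB
  have gψ := genPos_right_of_unextendible hgUPB
  constructor
  · rintro ⟨ρ, -, hρ, hpt, hrank, hker⟩
    exact (isGram_prodForm gφ gψ hρ hpt hrank hker).exists_perm
  · rintro ⟨κ, h1, h2, h3, h4⟩
    obtain ⟨A, hA, hAφ⟩ := exists_orthogonal_frame (gφ.comp κ) h1 h2
    obtain ⟨B, hB, hBψ⟩ := exists_orthogonal_frame ((gψ.comp κ).comp pentagramPerm)
      (by rwa [s1_comp_pentagramPerm]) (by rwa [s2_comp_pentagramPerm])
    obtain ⟨ρ, h0, hρ, hpt, hrank, hker⟩ :=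
      exists_ppt_of_orthogonal (φ := φ ∘ κ) (ψ := ψ ∘ κ) (fun i => hφ (κ i)) (fun i => hψ (κ i))
        hA hB (orthogonal_of_frames (x := fun i => A.mulVec ((φ ∘ κ) i))
          (y := fun i => B.mulVec ((ψ ∘ κ) i)) hAφ hBψ)
    refine ⟨ρ, h0, hρ, hpt, hrank, fun i => ?_⟩
    simpa using hker (κ.symm i)
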